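/- arXiv:1007.5440 — 3 statements merged into one kernel-verified Lean document; each statement's English description precedes it below -/
import Mathlib

section
/- Let k be a separably closed field of arbitrary characteristic, let A = k[x_i y_j : i,j = 0,…,n] be the homogeneous coordinate ring of the Segre embedding of P^n × P^n, and let I = (x_i y_j − x_j y_i : 0 ≤ i < j ≤ n) ⊆ A be the ideal defining the diagonal Δ(P^n) ⊆ P^n × P^n. Then ara_h(I) = 2n−1. -/
/-!
STATEMENT 4: Let `k` be a separably closed field of arbitrary characteristic, let
`A = k[xᵢyⱼ : i,j = 0,…,n]` be the homogeneous coordinate ring of the Segre embedding of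
`ℙⁿ × ℙⁿ`, and let `I = (xᵢyⱼ − xⱼyᵢ : 0 ≤ i < j ≤ n) ⊆ A` be the ideal defining the
diagonal `Δ(ℙⁿ) ⊆ ℙⁿ × ℙⁿ`.  Then `ara_h(I) = 2n−1`.

`A` is regarded as a graded subring of the polynomial ring `k[x₀,…,xₙ,y₀,…,yₙ]`; an element
of `A` is homogeneous exactly when it is a homogeneous polynomial.
-/

open MvPolynomial

/-- the variables `x_i` -/
noncomputable abbrev segX {k : Type*} [Field k] {n : ℕ} (i : Fin (n+1)) :
    MvPolynomial (Fin (n+1) ⊕ Fin (n+1)) k := X (Sum.inl i)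

/-- the variables `y_j` -/
noncomputable abbrev segY {k : Type*} [Field k] {n : ℕ} (j : Fin (n+1)) :
    MvPolynomial (Fin (n+1) ⊕ Fin (n+1)) k := X (Sum.inr j)

/-- `A = k[x_i y_j : 0 ≤ i,j ≤ n]`, the homogeneous coordinate ring of the Segre
embedding of `ℙⁿ × ℙⁿ`, as a subalgebra of `k[x₀,…,xₙ,y₀,…,yₙ]`. -/
noncomputable def segreCoordRing (k : Type*) [Field k] (n : ℕ) :
    Subalgebra k (MvPolynomial (Fin (n+1) ⊕ Fin (n+1)) k) :=
  Algebra.adjoin k (Set.range fun p : Fin (n+1) × Fin (n+1) => segX p.1 * segY p.2)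

/-- The ideal `I = (x_i y_j - x_j y_i : 0 ≤ i < j ≤ n)` of `A` defining the diagonal
`Δ(ℙⁿ) ⊆ ℙⁿ × ℙⁿ`. -/
noncomputable def diagonalIdeal (k : Type*) [Field k] (n : ℕ) :
    Ideal (segreCoordRing k n) :=
  Ideal.span {a : segreCoordRing k n | ∃ i j : Fin (n+1), i < j ∧
    (a : MvPolynomial (Fin (n+1) ⊕ Fin (n+1)) k) = segX i * segY j - segX j * segY i}

/-- homogeneous arithmetical rank of an ideal of `A`, where an element of `A` is
homogeneous when it is a homogeneous polynomial. -/
noncomputable def araHsub {k : Type*} [Field k] {n : ℕ}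
    (I : Ideal (segreCoordRing k n)) : ℕ :=
  sInf {t | ∃ f : Fin t → segreCoordRing k n,
    (∀ i, ∃ d, ((f i : MvPolynomial (Fin (n+1) ⊕ Fin (n+1)) k)).IsHomogeneous d) ∧
    (Ideal.span (Set.range f)).radical = I.radical}

/-- The composite of the forward differences with the steps in `l`. -/
def iterFwdDiff {M : Type*} [AddCommMonoid M] : List M → (M → ℤ) → M → ℤ
  | [], g => g
  | v :: l, g => iterFwdDiff l (fwdDiff v g)

lemma iterFwdDiff_sub {M : Type*} [AddCommMonoid M] (l : List M) (g h : M → ℤ) :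
    iterFwdDiff l (g - h) = iterFwdDiff l g - iterFwdDiff l h := by
  induction l generalizing g h with
  | nil => rfl
  | cons v l ih =>
    have : fwdDiff v (g - h) = fwdDiff v g - fwdDiff v h := by
      ext u; simp only [fwdDiff, Pi.sub_apply]; ring
    simp only [iterFwdDiff, this, ih]

lemma iterFwdDiff_shift {M : Type*} [AddCommMonoid M] (l : List M) (g : M → ℤ) (c : M) :
    iterFwdDiff l (fun u => g (u + c)) = fun u => iterFwdDiff l g (u + c) := by
  induction l generalizing g with
  | nil => rfl
  | cons v l ih =>
    have : fwdDiff v (fun u => g (u + c)) = fun u => fwdDiff v g (u + c) := by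
      ext u; simp only [fwdDiff, add_right_comm]
    simp only [iterFwdDiff, this, ih]

lemma iterFwdDiff_diagonal (l : List ℕ) (g : ℕ × ℕ → ℤ) (c : ℕ × ℕ) (t : ℕ) :
    iterFwdDiff (l.map fun d => (d, d)) g ((t, t) + c) =
      iterFwdDiff l (fun t => g ((t, t) + c)) t := by
  induction l generalizing g with
  | nil => rfl
  | cons d l ih =>
    simp only [List.map_cons, iterFwdDiff, ih]
    congr 1
    ext t
    simp only [fwdDiff]
    congr 2
    ext <;> simp <;> ring

/-- `g (a + 1, b) = g (a, b + 1)` for all large `a` and `b`. -/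
def EventuallyAntidiagConst (g : ℕ × ℕ → ℤ) : Prop :=
  ∃ c, ∀ a b, c ≤ a → c ≤ b → g (a + 1, b) = g (a, b + 1)

namespace EventuallyAntidiagConst

lemma sub {g h : ℕ × ℕ → ℤ} (hg : EventuallyAntidiagConst g) (hh : EventuallyAntidiagConst h) :
    EventuallyAntidiagConst (g - h) := by
  obtain ⟨c, hc⟩ := hg
  obtain ⟨e, he⟩ := hh
  refine ⟨max c e, fun a b ha hb => ?_⟩
  simp only [Pi.sub_apply]
  rw [hc a b (by omega) (by omega), he a b (by omega) (by omega)]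

lemma add {g h : ℕ × ℕ → ℤ} (hg : EventuallyAntidiagConst g) (hh : EventuallyAntidiagConst h) :
    EventuallyAntidiagConst (g + h) := by
  obtain ⟨c, hc⟩ := hg
  obtain ⟨e, he⟩ := hh
  refine ⟨max c e, fun a b ha hb => ?_⟩
  simp only [Pi.add_apply]
  rw [hc a b (by omega) (by omega), he a b (by omega) (by omega)]

lemma shift {g : ℕ × ℕ → ℤ} (hg : EventuallyAntidiagConst g) (v : ℕ × ℕ) :
    EventuallyAntidiagConst fun u => g (u + v) := by
  obtain ⟨c, hc⟩ := hg
  refine ⟨c, fun a b ha hb => ?_⟩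
  have := hc (a + v.1) (b + v.2) (by omega) (by omega)
  simpa only [Prod.add_def, add_right_comm] using this

end EventuallyAntidiagConst

open scoped Polynomial

lemma coeff_comp_X_add_C_sub_ne_zero (W : ℚ[X]) (hW : 0 < W.natDegree) {d : ℚ} (hd : d ≠ 0) :
    (W.comp (Polynomial.X + Polynomial.C d) - W).coeff (W.natDegree - 1) ≠ 0 := by
  obtain ⟨m, hm⟩ : ∃ m, W.natDegree = m + 1 := ⟨W.natDegree - 1, by omega⟩
  have hlead : W.coeff (m + 1) ≠ 0 := by
    rw [← hm]
    exact Polynomial.leadingCoeff_ne_zero.mpr (by rintro rfl; simp at hW)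
  have hdeg : (Polynomial.hasseDeriv m W).natDegree < 2 := by
    have := Polynomial.natDegree_hasseDeriv_le W m
    omega
  have key : (W.comp (Polynomial.X + Polynomial.C d) - W).coeff m =
      (m + 1) * W.coeff (m + 1) * d := by
    rw [Polynomial.coeff_sub, ← Polynomial.taylor_apply, Polynomial.taylor_coeff,
      Polynomial.eval_eq_sum_range' hdeg, Finset.sum_range_succ, Finset.sum_range_one,
      Polynomial.hasseDeriv_coeff, Polynomial.hasseDeriv_coeff, zero_add, add_comm 1 m]
    simp
  rw [hm, Nat.add_sub_cancel, key]
  have : (m : ℚ) + 1 ≠ 0 := by positivity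
  positivity

lemma not_eventually_iterFwdDiff_eq_zero (l : List ℕ) (hl : ∀ d ∈ l, 1 ≤ d) (g : ℕ → ℤ)
    (W : ℚ[X]) (hW : W ≠ 0) (hg : ∀ t, (g t : ℚ) = W.eval (t : ℚ)) (hlW : l.length ≤ W.natDegree)
    (c : ℕ) : ¬ ∀ t, c ≤ t → iterFwdDiff l g t = 0 := by
  induction l generalizing g W with
  | nil =>
    intro h
    refine hW (Polynomial.eq_zero_of_infinite_isRoot W (Set.Infinite.mono ?_
      ((Set.Ici_infinite c).image (Nat.cast_injective (R := ℚ)).injOn)))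
    rintro _ ⟨t, ht, rfl⟩
    simp only [Set.mem_ofPred_eq, Polynomial.IsRoot.def, ← hg]
    exact_mod_cast h t ht
  | cons d l ih =>
    have hd : (d : ℚ) ≠ 0 := by
      have := hl d (by simp)
      exact_mod_cast (by omega : d ≠ 0)
    rw [List.length_cons] at hlW
    have hne := coeff_comp_X_add_C_sub_ne_zero W (by omega) hd
    refine ih (fun e he => hl e (by simp [he])) (fwdDiff d g)
      (W.comp (Polynomial.X + Polynomial.C (d : ℚ)) - W) ?_ (fun t => ?_) ?_
    · exact fun h => hne (by rw [h, Polynomial.coeff_zero])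
    · simp [fwdDiff, hg]
    · have := Polynomial.le_natDegree_of_ne_zero hne
      omega

lemma exists_polynomial_choose_mul_choose_sub (n : ℕ) (hn : 1 ≤ n) :
    ∃ W : ℚ[X], W ≠ 0 ∧ W.natDegree = 2 * n - 2 ∧ ∀ t : ℕ,
      ((t + 2 + n).choose n : ℚ) * ((t + n).choose n : ℚ) - ((t + 1 + n).choose n : ℚ) ^ 2 =
        W.eval (t : ℚ) := by
  obtain ⟨m, rfl⟩ : ∃ m, n = m + 1 := ⟨n - 1, by omega⟩
  set c : ℚ := -(m + 1) / ((m + 1).factorial : ℚ) ^ 2 with hc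
  have hc0 : c ≠ 0 := by
    have : (m : ℚ) + 1 ≠ 0 := by positivity
    have := Nat.factorial_ne_zero (m + 1)
    simp only [hc, ne_eq, div_eq_zero_iff, neg_eq_zero]
    push Not
    exact ⟨by positivity, by positivity⟩
  have hdeg (e : ℚ) : ((ascPochhammer ℚ m).comp (Polynomial.X + Polynomial.C e)).natDegree =
      m := by
    simp [Polynomial.natDegree_comp]
  have hne (e : ℚ) : (ascPochhammer ℚ m).comp (Polynomial.X + Polynomial.C e) ≠ 0 :=
    ((monic_ascPochhammer ℚ m).comp_X_add_C e).ne_zero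
  refine ⟨Polynomial.C c * ((ascPochhammer ℚ m).comp (Polynomial.X + Polynomial.C 2) *
    (ascPochhammer ℚ m).comp (Polynomial.X + Polynomial.C 3)),
    ?_, ?_, fun t => ?_⟩
  · exact mul_ne_zero (Polynomial.C_ne_zero.mpr hc0) (mul_ne_zero (hne 2) (hne 3))
  · rw [Polynomial.natDegree_C_mul hc0, Polynomial.natDegree_mul (hne 2) (hne 3), hdeg, hdeg]
    omega
  · have h2 (s : ℕ) : ((m + 1).factorial : ℚ) * ((s + (m + 1)).choose (m + 1) : ℚ) =
        (s + m + 1) * (ascPochhammer ℚ m).eval ((s : ℚ) + 1) := by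
      have h := Nat.ascFactorial_eq_factorial_mul_choose s (m + 1)
      rw [Nat.ascFactorial_succ] at h
      have h' := congrArg (Nat.cast (R := ℚ)) h
      push_cast [Nat.cast_ascFactorial] at h'
      rw [← h']
      ring
    have h1 (s : ℕ) : ((m + 1).factorial : ℚ) * ((s + (m + 1)).choose (m + 1) : ℚ) =
        (s + 1) * (ascPochhammer ℚ m).eval ((s : ℚ) + 2) := by
      have h := congrArg (Nat.cast (R := ℚ)) (Nat.succ_ascFactorial (s + 1) m)
      push_cast [Nat.cast_ascFactorial] at h
      rw [h2, show (s : ℚ) + 2 = s + 1 + 1 by ring, h]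
      ring
    have hf : ((m + 1).factorial : ℚ) ≠ 0 := by
      exact_mod_cast Nat.factorial_ne_zero (m + 1)
    have e1 := h1 t
    have e2 := h1 (t + 1)
    have e3 := h2 (t + 1)
    have e4 := h2 (t + 2)
    push_cast at e1 e2 e3 e4
    rw [show (t : ℚ) + 1 + 2 = t + 3 by ring] at e2
    rw [show (t : ℚ) + 1 + 1 = t + 2 by ring] at e3
    rw [show (t : ℚ) + 2 + 1 = t + 3 by ring] at e4
    simp only [Polynomial.eval_mul, Polynomial.eval_C, Polynomial.eval_comp,
      Polynomial.eval_add, Polynomial.eval_X]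
    rw [hc]
    field_simp
    generalize ((m + 1).factorial : ℚ) = F at *
    generalize (ascPochhammer ℚ m).eval ((t : ℚ) + 2) = p at *
    generalize (ascPochhammer ℚ m).eval ((t : ℚ) + 3) = q at *
    generalize (((t + 2 + (m + 1)).choose (m + 1) : ℕ) : ℚ) = A at *
    generalize (((t + 1 + (m + 1)).choose (m + 1) : ℕ) : ℚ) = B at *
    generalize (((t + (m + 1)).choose (m + 1) : ℕ) : ℚ) = D at *
    linear_combination F * D * e4 + (t + 2 + m + 1) * q * e1 - F * B * e2 - (t + 1 + 1) * q * e3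

lemma not_eventuallyAntidiagConst_iterFwdDiff (n : ℕ) (hn : 1 ≤ n) (l : List ℕ)
    (hl : ∀ d ∈ l, 1 ≤ d) (hlen : l.length ≤ 2 * n - 2) :
    ¬ EventuallyAntidiagConst (iterFwdDiff (l.map fun d => (d, d))
      fun u => ((u.1 + n).choose n * (u.2 + n).choose n : ℕ)) := by
  rintro ⟨c, hc⟩
  obtain ⟨W, hW, hdeg, hWeval⟩ := exists_polynomial_choose_mul_choose_sub n hn
  set P : ℕ × ℕ → ℤ := fun u => ((u.1 + n).choose n * (u.2 + n).choose n : ℕ) with hP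
  refine not_eventually_iterFwdDiff_eq_zero l hl
    ((fun t => P ((t, t) + (2, 0))) - fun t => P ((t, t) + (1, 1))) W hW (fun t => ?_)
    (hlen.trans hdeg.ge) c (fun t ht => ?_)
  · rw [← hWeval]
    simp only [hP, Pi.sub_apply, Prod.mk_add_mk, add_zero]
    push_cast
    ring
  · rw [iterFwdDiff_sub, Pi.sub_apply, ← iterFwdDiff_diagonal, ← iterFwdDiff_diagonal, sub_eq_zero]
    exact hc (t + 1) t (by omega) ht
/-- The bidegrees of the variables of `k[x, y]`. -/
def bidegree (σ : Type*) : σ ⊕ σ → ℕ × ℕ := Sum.elim (fun _ => (1, 0)) fun _ => (0, 1)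

/-- The bihomogeneous components of `k[x, y]`. -/
noncomputable abbrev bihomogeneousSubmodule (k σ : Type*) [Field k] (u : ℕ × ℕ) :
    Submodule k (MvPolynomial (σ ⊕ σ) k) :=
  weightedHomogeneousSubmodule k (bidegree σ) u

noncomputable instance (k σ : Type*) [Field k] : GradedAlgebra (bihomogeneousSubmodule k σ) :=
  weightedGradedAlgebra k (bidegree σ)

lemma weight_bidegree {σ : Type*} [Fintype σ] (d : σ ⊕ σ →₀ ℕ) :
    Finsupp.weight (bidegree σ) d = (∑ i, d (Sum.inl i), ∑ i, d (Sum.inr i)) := by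
  rw [Finsupp.weight_apply, Finsupp.sum_fintype _ _ (by simp), Fintype.sum_sum_type]
  ext <;> simp [bidegree, Prod.fst_sum, Prod.snd_sum]

/-- The monomials of bidegree `(a, b)` are the pairs of a monomial of degree `a` and one of
degree `b`. -/
noncomputable def bidegreeEquivSym (σ : Type*) [Fintype σ] [DecidableEq σ] (a b : ℕ) :
    {d : σ ⊕ σ →₀ ℕ | Finsupp.weight (bidegree σ) d = (a, b)} ≃ Sym σ a × Sym σ b :=
  Equiv.trans
    { toFun := fun d =>
        (⟨fun i => d.1 (Sum.inl i), (Prod.mk.inj ((weight_bidegree d.1).symm.trans d.2)).1⟩,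
          ⟨fun i => d.1 (Sum.inr i), (Prod.mk.inj ((weight_bidegree d.1).symm.trans d.2)).2⟩)
      invFun := fun p => ⟨Finsupp.equivFunOnFinite.symm (Sum.elim p.1.1 p.2.1), by
        rw [Set.mem_ofPred_eq, weight_bidegree]
        simp [p.1.2, p.2.2]⟩
      left_inv := fun d => by
        ext i
        rcases i with i | i <;> simp
      right_inv := fun p => by
        ext i <;> simp }
    (Equiv.prodCongr (Sym.equivNatSumOfFintype σ a).symm (Sym.equivNatSumOfFintype σ b).symm)

section HilbertFunction

variable {k σ : Type*} [Field k]

lemma finrank_bihomogeneousSubmodule [Fintype σ] (n a b : ℕ) (hσ : Fintype.card σ = n + 1) :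
    Module.finrank k (bihomogeneousSubmodule k σ (a, b)) =
      (a + n).choose n * (b + n).choose n := by
  classical
  rw [bihomogeneousSubmodule, weightedHomogeneousSubmodule_eq_finsupp_supported]
  change Module.finrank k (restrictSupport k _) = _
  rw [Module.finrank_eq_nat_card_basis
    (basisRestrictSupport k {d | Finsupp.weight (bidegree σ) d = (a, b)}),
    Nat.card_congr (bidegreeEquivSym σ a b), Nat.card_prod, Nat.card_eq_fintype_card,
    Nat.card_eq_fintype_card, Sym.card_sym_eq_choose, Sym.card_sym_eq_choose, hσ]
  rw [show n + 1 + a - 1 = a + n by omega, show n + 1 + b - 1 = b + n by omega,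
    Nat.choose_symm_add, Nat.choose_symm_add]

instance [Fintype σ] (u : ℕ × ℕ) : FiniteDimensional k (bihomogeneousSubmodule k σ u) := by
  classical
  rw [bihomogeneousSubmodule, weightedHomogeneousSubmodule_eq_finsupp_supported]
  have := Finite.of_equiv _ (bidegreeEquivSym σ u.1 u.2).symm
  exact Module.Finite.of_basis
    (basisRestrictSupport k {d | Finsupp.weight (bidegree σ) d = u})

/-- The degree `u` part of an ideal of `k[x, y]`. -/
noncomputable def idealComponent (L : Ideal (MvPolynomial (σ ⊕ σ) k)) (u : ℕ × ℕ) :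
    Submodule k (MvPolynomial (σ ⊕ σ) k) :=
  L.restrictScalars k ⊓ bihomogeneousSubmodule k σ u

lemma mem_idealComponent {L : Ideal (MvPolynomial (σ ⊕ σ) k)} {u : ℕ × ℕ}
    {p : MvPolynomial (σ ⊕ σ) k} :
    p ∈ idealComponent L u ↔ p ∈ L ∧ p ∈ bihomogeneousSubmodule k σ u := Iff.rfl

instance [Fintype σ] (L : Ideal (MvPolynomial (σ ⊕ σ) k)) (u : ℕ × ℕ) :
    FiniteDimensional k (idealComponent L u) :=
  Submodule.finiteDimensional_inf_right _ _

/-- The bigraded Hilbert function of an ideal of `k[x, y]`. -/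
noncomputable def hilbertFn (L : Ideal (MvPolynomial (σ ⊕ σ) k)) (u : ℕ × ℕ) : ℤ :=
  Module.finrank k (idealComponent L u)

lemma hilbertFn_bot : hilbertFn (⊥ : Ideal (MvPolynomial (σ ⊕ σ) k)) = 0 := by
  ext u
  have : idealComponent (⊥ : Ideal (MvPolynomial (σ ⊕ σ) k)) u = ⊥ := by
    simp [idealComponent]
  rw [hilbertFn, this, finrank_bot]
  rfl

lemma hilbertFn_top [Fintype σ] (n : ℕ) (hσ : Fintype.card σ = n + 1) (u : ℕ × ℕ) :
    hilbertFn (⊤ : Ideal (MvPolynomial (σ ⊕ σ) k)) u =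
      ((u.1 + n).choose n * (u.2 + n).choose n : ℕ) := by
  have : idealComponent (⊤ : Ideal (MvPolynomial (σ ⊕ σ) k)) u =
      bihomogeneousSubmodule k σ (u.1, u.2) := by
    simp [idealComponent]
  rw [hilbertFn, this, finrank_bihomogeneousSubmodule n _ _ hσ]

lemma finrank_map_add_finrank_inf_ker {V W : Type*} [AddCommGroup V] [Module k V]
    [AddCommGroup W] [Module k W] (P : Submodule k V) [FiniteDimensional k P] (g : V →ₗ[k] W) :
    Module.finrank k (P.map g) + Module.finrank k (P ⊓ LinearMap.ker g : Submodule k V) =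
      Module.finrank k P := by
  rw [← LinearMap.finrank_range_add_finrank_ker (g.domRestrict P)]
  congr 1
  · rw [LinearMap.range_domRestrict]
  · rw [LinearMap.ker_domRestrict, ← Submodule.map_comap_subtype,
      Submodule.finrank_map_subtype_eq]

/-- The elements of `L` that multiplication by `f` sends into `N`. -/
noncomputable def mulKer (L N : Ideal (MvPolynomial (σ ⊕ σ) k)) (f : MvPolynomial (σ ⊕ σ) k) :
    Ideal (MvPolynomial (σ ⊕ σ) k) :=
  L ⊓ Submodule.comap (LinearMap.mulLeft (MvPolynomial (σ ⊕ σ) k) f) N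

lemma mem_mulKer {L N : Ideal (MvPolynomial (σ ⊕ σ) k)} {f p : MvPolynomial (σ ⊕ σ) k} :
    p ∈ mulKer L N f ↔ p ∈ L ∧ f * p ∈ N := Iff.rfl

local notation "𝓑" => bihomogeneousSubmodule k σ

lemma mulKer_isHomogeneous {L N : Ideal (MvPolynomial (σ ⊕ σ) k)} {f : MvPolynomial (σ ⊕ σ) k}
    {v : ℕ × ℕ} (hL : L.IsHomogeneous 𝓑) (hN : N.IsHomogeneous 𝓑) (hf : f ∈ 𝓑 v) :
    (mulKer L N f).IsHomogeneous 𝓑 := by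
  intro u p hp
  rw [mem_mulKer] at hp ⊢
  refine ⟨hL u hp.1, ?_⟩
  rw [← DirectSum.coe_decompose_mul_add_of_left_mem 𝓑 hf]
  exact hN _ hp.2

lemma span_singleton_mul_sup_isHomogeneous {L N : Ideal (MvPolynomial (σ ⊕ σ) k)}
    {f : MvPolynomial (σ ⊕ σ) k} {v : ℕ × ℕ} (hL : L.IsHomogeneous 𝓑) (hN : N.IsHomogeneous 𝓑)
    (hf : f ∈ 𝓑 v) : (Ideal.span {f} * L ⊔ N).IsHomogeneous 𝓑 :=
  ((Ideal.homogeneous_span 𝓑 {f} (by rintro _ rfl; exact ⟨v, hf⟩)).mul hL).sup hN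

/-- Rank-nullity for multiplication by `f` on `L / N`. -/
lemma hilbertFn_sub_mulKer [Fintype σ] {L N : Ideal (MvPolynomial (σ ⊕ σ) k)}
    {f : MvPolynomial (σ ⊕ σ) k} {v : ℕ × ℕ} (hL : L.IsHomogeneous 𝓑) (hN : N.IsHomogeneous 𝓑)
    (hf : f ∈ 𝓑 v) (u : ℕ × ℕ) :
    hilbertFn L u - hilbertFn (mulKer L N f) u =
      hilbertFn (Ideal.span {f} * L ⊔ N) (u + v) - hilbertFn N (u + v) := by
  set q := (N.restrictScalars k).mkQ
  set g := q ∘ₗ LinearMap.mulLeft k f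
  have h1 := finrank_map_add_finrank_inf_ker (idealComponent L u) g
  have h2 := finrank_map_add_finrank_inf_ker (idealComponent (Ideal.span {f} * L ⊔ N) (u + v)) q
  have e1 : idealComponent L u ⊓ LinearMap.ker g = idealComponent (mulKer L N f) u := by
    ext p
    simp only [Submodule.mem_inf, mem_idealComponent, mem_mulKer, LinearMap.mem_ker, g, q,
      LinearMap.comp_apply, Submodule.mkQ_apply, Submodule.Quotient.mk_eq_zero,
      Submodule.restrictScalars_mem, LinearMap.mulLeft_apply]
    tauto
  have e2 : idealComponent (Ideal.span {f} * L ⊔ N) (u + v) ⊓ LinearMap.ker q =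
      idealComponent N (u + v) := by
    ext p
    simp only [Submodule.mem_inf, mem_idealComponent, LinearMap.mem_ker, q,
      Submodule.mkQ_apply, Submodule.Quotient.mk_eq_zero, Submodule.restrictScalars_mem]
    have : p ∈ N → p ∈ Ideal.span {f} * L ⊔ N := fun h => le_sup_right (a := Ideal.span {f} * L) h
    tauto
  have e3 : (idealComponent L u).map g =
      (idealComponent (Ideal.span {f} * L ⊔ N) (u + v)).map q := by
    apply le_antisymm
    · rintro _ ⟨p, hp, rfl⟩
      refine ⟨f * p, ⟨?_, ?_⟩, rfl⟩
      · exact Ideal.mem_sup_left (Ideal.mul_mem_mul (Ideal.mem_span_singleton_self f) hp.1)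
      · rw [add_comm]
        exact SetLike.mul_mem_graded hf hp.2
    · rintro _ ⟨p, hp, rfl⟩
      obtain ⟨r, hr, s, hs, hrs⟩ := Submodule.mem_sup.mp hp.1
      obtain ⟨l, hl, rfl⟩ := Ideal.mem_span_singleton_mul.mp hr
      refine ⟨DirectSum.decompose 𝓑 l u, ⟨hL u hl, SetLike.coe_mem _⟩, ?_⟩
      have key : p = f * (DirectSum.decompose 𝓑 l u : MvPolynomial (σ ⊕ σ) k) +
          DirectSum.decompose 𝓑 s (u + v) := by
        rw [← DirectSum.coe_decompose_mul_add_of_left_mem 𝓑 hf, add_comm v u,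
          ← Submodule.coe_add, ← DirectSum.add_apply, ← DirectSum.decompose_add, hrs,
          DirectSum.decompose_of_mem_same 𝓑 hp.2]
      rw [key, map_add]
      have : q (DirectSum.decompose 𝓑 s (u + v)) = 0 :=
        (Submodule.Quotient.mk_eq_zero _).mpr (hN (u + v) hs)
      rw [this, add_zero]
      rfl
  rw [e1, e3] at h1
  rw [e2] at h2
  simp only [hilbertFn]
  omega

/-- High degree elements of a homogeneous ideal `L` lie in `𝔪 * L`. -/
lemma exists_forall_mem_mul [Finite σ] {L 𝔪 : Ideal (MvPolynomial (σ ⊕ σ) k)}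
    (hL : L.IsHomogeneous 𝓑) (π : ℕ × ℕ →+ ℕ) (h𝔪 : ∀ u, 0 < π u → ∀ p ∈ 𝓑 u, p ∈ 𝔪) :
    ∃ c, ∀ u, c ≤ π u → ∀ p ∈ idealComponent L u, p ∈ 𝔪 * L := by
  classical
  obtain ⟨S, hS⟩ := (Ideal.IsHomogeneous.iff_exists _ _).mp hL
  obtain ⟨T, hTS, hT⟩ := (Submodule.fg_span_iff_fg_span_finset_subset _).mp
    (hS ▸ IsNoetherian.noetherian L :
      (Submodule.span _ ((↑) '' S : Set (MvPolynomial (σ ⊕ σ) k))).FG)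
  have hdeg : ∀ g ∈ T, ∃ v, g ∈ 𝓑 v := by
    intro g hg
    obtain ⟨s, -, rfl⟩ := hTS hg
    exact s.2
  choose! v hv using hdeg
  refine ⟨T.sup (fun g => π (v g)) + 1, fun u hu p hp => ?_⟩
  have hTL : ∀ g ∈ T, g ∈ L := fun g hg => by
    rw [hS]
    exact Ideal.subset_span (hTS hg)
  have hpT : p ∈ Submodule.span (MvPolynomial (σ ⊕ σ) k) (T : Set (MvPolynomial (σ ⊕ σ) k)) := by
    rw [← hT]
    exact hS.le hp.1
  obtain ⟨r, -, rfl⟩ := Submodule.mem_span_finset.mp hpT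
  rw [← DirectSum.decompose_of_mem_same 𝓑 hp.2, DirectSum.decompose_sum, DFinsupp.finsetSum_apply,
    AddSubmonoidClass.coe_finsetSum]
  refine Ideal.sum_mem _ fun g hg => ?_
  rw [smul_eq_mul, DirectSum.coe_decompose_mul_of_right_mem 𝓑 u (hv g hg)]
  split_ifs with hle
  · refine Ideal.mul_mem_mul (h𝔪 (u - v g) ?_ _ (SetLike.coe_mem _)) (hTL g hg)
    have h1 : π (u - v g) + π (v g) = π u := by rw [← map_add, tsub_add_cancel_of_le hle]
    have h2 : π (v g) ≤ T.sup fun g => π (v g) := Finset.le_sup (f := fun g => π (v g)) hg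
    omega
  · exact Ideal.zero_mem _

lemma X_inl_mem (i : σ) : (X (Sum.inl i) : MvPolynomial (σ ⊕ σ) k) ∈ 𝓑 (1, 0) :=
  isWeightedHomogeneous_X k _ _

lemma X_inr_mem (i : σ) : (X (Sum.inr i) : MvPolynomial (σ ⊕ σ) k) ∈ 𝓑 (0, 1) :=
  isWeightedHomogeneous_X k _ _

variable (k σ) in
/-- The ideal generated by the variables `x_i`. -/
noncomputable def idealX : Ideal (MvPolynomial (σ ⊕ σ) k) :=
  Ideal.span (Set.range fun i => X (Sum.inl i))

variable (k σ) in
/-- The ideal generated by the variables `y_i`. -/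
noncomputable def idealY : Ideal (MvPolynomial (σ ⊕ σ) k) :=
  Ideal.span (Set.range fun i => X (Sum.inr i))

lemma mem_idealX [Fintype σ] (u : ℕ × ℕ) (hu : 0 < u.1) (p : MvPolynomial (σ ⊕ σ) k)
    (hp : p ∈ 𝓑 u) : p ∈ idealX k σ := by
  rw [idealX, Set.range_comp' X Sum.inl, mem_ideal_span_X_image]
  intro m hm
  have h := hp (mem_support_iff.mp hm)
  rw [weight_bidegree] at h
  subst h
  obtain ⟨i, -, hi⟩ := Finset.exists_ne_zero_of_sum_ne_zero hu.ne'
  exact ⟨Sum.inl i, ⟨i, rfl⟩, hi⟩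

lemma mem_idealY [Fintype σ] (u : ℕ × ℕ) (hu : 0 < u.2) (p : MvPolynomial (σ ⊕ σ) k)
    (hp : p ∈ 𝓑 u) : p ∈ idealY k σ := by
  rw [idealY, Set.range_comp' X Sum.inr, mem_ideal_span_X_image]
  intro m hm
  have h := hp (mem_support_iff.mp hm)
  rw [weight_bidegree] at h
  subst h
  obtain ⟨i, -, hi⟩ := Finset.exists_ne_zero_of_sum_ne_zero hu.ne'
  exact ⟨Sum.inr i, ⟨i, rfl⟩, hi⟩

variable (k σ) in
/-- The ideal generated by the `2 × 2` minors `x_i y_j - x_j y_i`. -/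
noncomputable def minorIdeal : Ideal (MvPolynomial (σ ⊕ σ) k) :=
  Ideal.span (Set.range fun p : σ × σ =>
    X (Sum.inl p.1) * X (Sum.inr p.2) - X (Sum.inl p.2) * X (Sum.inr p.1))

lemma minor_mem_minorIdeal (i j : σ) : (X (Sum.inl i) * X (Sum.inr j) -
    X (Sum.inl j) * X (Sum.inr i) : MvPolynomial (σ ⊕ σ) k) ∈ minorIdeal k σ :=
  Ideal.subset_span ⟨(i, j), rfl⟩

lemma minorIdeal_isHomogeneous : (minorIdeal k σ).IsHomogeneous 𝓑 := by
  refine Ideal.homogeneous_span 𝓑 _ ?_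
  rintro _ ⟨⟨i, j⟩, rfl⟩
  exact ⟨(1, 0) + (0, 1), sub_mem (SetLike.mul_mem_graded (X_inl_mem i) (X_inr_mem j))
    (SetLike.mul_mem_graded (X_inl_mem j) (X_inr_mem i))⟩

section Minors

variable {L N : Ideal (MvPolynomial (σ ⊕ σ) k)}

lemma X_inl_mul_mem_of_mem_idealY_mul (hJ : minorIdeal k σ * L ≤ N) (i : σ)
    {p : MvPolynomial (σ ⊕ σ) k} (hp : p ∈ idealY k σ * L) :
    X (Sum.inl i) * p ∈ Ideal.span {X (Sum.inr i)} * L ⊔ N := by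
  induction hp using Submodule.mul_induction_on' with
  | mem_mul_mem a ha l hl =>
    induction ha using Submodule.span_induction with
    | mem a ha =>
      obtain ⟨j, rfl⟩ := ha
      rw [show (X (Sum.inl i) * (X (Sum.inr j) * l) : MvPolynomial (σ ⊕ σ) k) =
        X (Sum.inr i) * (X (Sum.inl j) * l) + (X (Sum.inl i) * X (Sum.inr j) -
          X (Sum.inl j) * X (Sum.inr i)) * l by ring]
      exact add_mem (Ideal.mem_sup_left (Ideal.mul_mem_mul (Ideal.mem_span_singleton_self _)
        (Ideal.mul_mem_left _ _ hl)))
        (Ideal.mem_sup_right (hJ (Ideal.mul_mem_mul (minor_mem_minorIdeal i j) hl)))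
    | zero => simp
    | add a b _ _ iha ihb =>
      rw [add_mul, mul_add]
      exact add_mem iha ihb
    | smul r a _ iha =>
      rw [smul_eq_mul, mul_assoc, mul_left_comm]
      exact Ideal.mul_mem_left _ _ iha
  | add a _ b _ iha ihb =>
    rw [mul_add]
    exact add_mem iha ihb

lemma X_inr_mul_mem_of_mem_idealX_mul (hJ : minorIdeal k σ * L ≤ N) (i : σ)
    {p : MvPolynomial (σ ⊕ σ) k} (hp : p ∈ idealX k σ * L) :
    X (Sum.inr i) * p ∈ Ideal.span {X (Sum.inl i)} * L ⊔ N := by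
  induction hp using Submodule.mul_induction_on' with
  | mem_mul_mem a ha l hl =>
    induction ha using Submodule.span_induction with
    | mem a ha =>
      obtain ⟨j, rfl⟩ := ha
      rw [show (X (Sum.inr i) * (X (Sum.inl j) * l) : MvPolynomial (σ ⊕ σ) k) =
        X (Sum.inl i) * (X (Sum.inr j) * l) + (X (Sum.inl j) * X (Sum.inr i) -
          X (Sum.inl i) * X (Sum.inr j)) * l by ring]
      exact add_mem (Ideal.mem_sup_left (Ideal.mul_mem_mul (Ideal.mem_span_singleton_self _)
        (Ideal.mul_mem_left _ _ hl)))
        (Ideal.mem_sup_right (hJ (Ideal.mul_mem_mul (minor_mem_minorIdeal j i) hl)))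
    | zero => simp
    | add a b _ _ iha ihb =>
      rw [add_mul, mul_add]
      exact add_mem iha ihb
    | smul r a _ iha =>
      rw [smul_eq_mul, mul_assoc, mul_left_comm]
      exact Ideal.mul_mem_left _ _ iha
  | add a _ b _ iha ihb =>
    rw [mul_add]
    exact add_mem iha ihb

lemma span_singleton_mul_mulKer_le (f : MvPolynomial (σ ⊕ σ) k) :
    Ideal.span {f} * mulKer L N f ≤ N := by
  rw [Ideal.mul_le]
  intro r hr s hs
  obtain ⟨t, rfl⟩ := Ideal.mem_span_singleton'.mp hr
  rw [mul_assoc]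
  exact Ideal.mul_mem_left _ _ hs.2

lemma le_mulKer (hNL : N ≤ L) (f : MvPolynomial (σ ⊕ σ) k) : N ≤ mulKer L N f :=
  fun _ hp => ⟨hNL hp, Ideal.mul_mem_left _ _ hp⟩

/-- The elements of `L / N` killed by `x_i` and by `y_i` agree in large degrees. -/
lemma exists_idealComponent_mulKer_eq [Fintype σ] (hL : L.IsHomogeneous 𝓑)
    (hN : N.IsHomogeneous 𝓑) (hJ : minorIdeal k σ * L ≤ N) (i : σ) :
    ∃ c, ∀ a b, c ≤ a → c ≤ b → idealComponent (mulKer L N (X (Sum.inl i))) (a, b) =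
      idealComponent (mulKer L N (X (Sum.inr i))) (a, b) := by
  obtain ⟨c, hc⟩ := exists_forall_mem_mul (mulKer_isHomogeneous hL hN (X_inl_mem i))
    (AddMonoidHom.fst ℕ ℕ) mem_idealX
  obtain ⟨e, he⟩ := exists_forall_mem_mul (mulKer_isHomogeneous hL hN (X_inr_mem i))
    (AddMonoidHom.snd ℕ ℕ) mem_idealY
  have hJK (f : MvPolynomial (σ ⊕ σ) k) : minorIdeal k σ * mulKer L N f ≤ N :=
    (Ideal.mul_mono_right inf_le_left).trans hJ
  refine ⟨max c e, fun a b ha hb => le_antisymm ?_ ?_⟩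
  · intro p hp
    refine ⟨⟨hp.1.1, ?_⟩, hp.2⟩
    have := X_inr_mul_mem_of_mem_idealX_mul (hJK _) i
      (hc (a, b) (le_trans (le_max_left _ _) ha) p hp)
    rwa [sup_eq_right.mpr (span_singleton_mul_mulKer_le _)] at this
  · intro p hp
    refine ⟨⟨hp.1.1, ?_⟩, hp.2⟩
    have := X_inl_mul_mem_of_mem_idealY_mul (hJK _) i
      (he (a, b) (le_trans (le_max_right _ _) hb) p hp)
    rwa [sup_eq_right.mpr (span_singleton_mul_mulKer_le _)] at this

/-- The ideals `x_i * L + N` and `y_i * L + N` agree in large degrees. -/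
lemma exists_idealComponent_span_mul_sup_eq [Fintype σ] (hL : L.IsHomogeneous 𝓑)
    (hN : N.IsHomogeneous 𝓑) (hJ : minorIdeal k σ * L ≤ N) (i : σ) :
    ∃ c, ∀ a b, c ≤ a → c ≤ b →
      idealComponent (Ideal.span {X (Sum.inl i)} * L ⊔ N) (a + 1, b + 1) =
        idealComponent (Ideal.span {X (Sum.inr i)} * L ⊔ N) (a + 1, b + 1) := by
  have key (f : MvPolynomial (σ ⊕ σ) k) (v u : ℕ × ℕ) (hf : f ∈ 𝓑 v) (M : Ideal _) (hM : N ≤ M)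
      (h : ∀ p ∈ idealComponent L u, f * p ∈ M) :
      ∀ p ∈ idealComponent (Ideal.span {f} * L ⊔ N) (v + u), p ∈ M := by
    intro p hp
    obtain ⟨r, hr, s, hs, hrs⟩ := Submodule.mem_sup.mp hp.1
    obtain ⟨l, hl, rfl⟩ := Ideal.mem_span_singleton_mul.mp hr
    rw [← DirectSum.decompose_of_mem_same 𝓑 hp.2, ← hrs, DirectSum.decompose_add,
      DirectSum.add_apply, Submodule.coe_add, DirectSum.coe_decompose_mul_add_of_left_mem 𝓑 hf]
    exact add_mem (h _ ⟨hL u hl, SetLike.coe_mem _⟩) (hM (hN _ hs))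
  obtain ⟨c, hc⟩ := exists_forall_mem_mul hL (AddMonoidHom.fst ℕ ℕ) mem_idealX
  obtain ⟨e, he⟩ := exists_forall_mem_mul hL (AddMonoidHom.snd ℕ ℕ) mem_idealY
  refine ⟨max c e, fun a b ha hb => le_antisymm ?_ ?_⟩
  · refine fun p hp => ⟨key _ (1, 0) (a, b + 1) (X_inl_mem i) _ le_sup_right (fun l hl =>
      X_inl_mul_mem_of_mem_idealY_mul hJ i (he _ ?_ l hl)) p ?_, hp.2⟩
    · exact (le_trans (le_max_right c e) hb).trans (Nat.le_succ b)
    · simpa [add_comm] using hp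
  · refine fun p hp => ⟨key _ (0, 1) (a + 1, b) (X_inr_mem i) _ le_sup_right (fun l hl =>
      X_inr_mul_mem_of_mem_idealX_mul hJ i (hc _ ?_ l hl)) p ?_, hp.2⟩
    · exact (le_trans (le_max_left c e) ha).trans (Nat.le_succ a)
    · simpa [add_comm] using hp

lemma eventuallyAntidiagConst_of_minorIdeal_mul_le_of_X_mul_le [Fintype σ]
    (hL : L.IsHomogeneous 𝓑) (hN : N.IsHomogeneous 𝓑) (hNL : N ≤ L)
    (hJ : minorIdeal k σ * L ≤ N) (s : Finset σ)
    (hs : ∀ i ∉ s, ∀ p ∈ L, X (Sum.inl i) * p ∈ N) :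
    EventuallyAntidiagConst (hilbertFn L - hilbertFn N) := by
  classical
  induction s using Finset.induction_on generalizing L with
  | empty =>
    have hXL : idealX k σ * L ≤ N := by
      rw [Ideal.mul_le]
      intro r hr p hp
      have : idealX k σ ≤ Submodule.comap (LinearMap.mulRight (MvPolynomial (σ ⊕ σ) k) p) N := by
        refine Ideal.span_le.mpr ?_
        rintro _ ⟨i, rfl⟩
        exact hs i (by simp) p hp
      exact this hr
    obtain ⟨c, hc⟩ := exists_forall_mem_mul hL (AddMonoidHom.fst ℕ ℕ) mem_idealX
    have heq (u : ℕ × ℕ) (hu : c ≤ u.1) : hilbertFn L u = hilbertFn N u := by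
      have : idealComponent L u = idealComponent N u := le_antisymm
        (fun p hp => ⟨hXL (hc u hu p hp), hp.2⟩) (fun p hp => ⟨hNL hp.1, hp.2⟩)
      rw [hilbertFn, hilbertFn, this]
    refine ⟨c, fun a b ha hb => ?_⟩
    rw [Pi.sub_apply, Pi.sub_apply, heq (a + 1, b) (ha.trans (Nat.le_succ a)), heq (a, b + 1) ha]
    ring
  | insert i s _ ih =>
    have hK := mulKer_isHomogeneous hL hN (X_inl_mem i)
    obtain ⟨c, hc⟩ := ih hK (le_mulKer hNL _)
      ((Ideal.mul_mono_right inf_le_left).trans hJ) (fun j hj p hp => by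
        by_cases hji : j = i
        · subst hji
          exact hp.2
        · exact hs j (by simp [hji, hj]) p hp.1)
    obtain ⟨e, he⟩ := exists_idealComponent_mulKer_eq hL hN hJ i
    obtain ⟨o, ho⟩ := exists_idealComponent_span_mul_sup_eq hL hN hJ i
    refine ⟨max c (max e o), fun a b ha hb => ?_⟩
    have h1 := hilbertFn_sub_mulKer hL hN (X_inl_mem i) (a, b + 1)
    have h2 := hilbertFn_sub_mulKer hL hN (X_inr_mem i) (a + 1, b)
    have h3 := hc a b (by omega) (by omega)
    have h4 : hilbertFn (mulKer L N (X (Sum.inl i))) (a + 1, b) =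
        hilbertFn (mulKer L N (X (Sum.inr i))) (a + 1, b) := by
      rw [hilbertFn, he (a + 1) b (by omega) (by omega), hilbertFn]
    have h5 : hilbertFn (Ideal.span {X (Sum.inl i)} * L ⊔ N) (a + 1, b + 1) =
        hilbertFn (Ideal.span {X (Sum.inr i)} * L ⊔ N) (a + 1, b + 1) := by
      rw [hilbertFn, ho a b (by omega) (by omega), hilbertFn]
    simp only [Prod.mk_add_mk, add_zero, Pi.sub_apply] at h1 h2 h3 ⊢
    omega

lemma eventuallyAntidiagConst_of_minorIdeal_pow_mul_le [Fintype σ] (m : ℕ)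
    (hL : L.IsHomogeneous 𝓑) (hN : N.IsHomogeneous 𝓑) (hNL : N ≤ L)
    (hJ : minorIdeal k σ ^ m * L ≤ N) :
    EventuallyAntidiagConst (hilbertFn L - hilbertFn N) := by
  induction m generalizing L with
  | zero =>
    rw [pow_zero, one_mul] at hJ
    rw [le_antisymm hJ hNL, sub_self]
    exact ⟨0, fun _ _ _ _ => rfl⟩
  | succ m ih =>
    set M := minorIdeal k σ * L ⊔ N
    have hM : M.IsHomogeneous 𝓑 := (minorIdeal_isHomogeneous.mul hL).sup hN
    have hML : M ≤ L := sup_le Ideal.mul_le_right hNL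
    have h1 := eventuallyAntidiagConst_of_minorIdeal_mul_le_of_X_mul_le hL hM hML le_sup_left
      Finset.univ (by simp)
    have h2 := ih hM le_sup_right (by
      rw [Ideal.mul_sup, ← mul_assoc, ← pow_succ]
      exact sup_le hJ Ideal.mul_le_right)
    simpa using h1.add h2

/-- If the minors are nilpotent modulo an annihilator `K` of `L / N` and the forms in `l`, then
the differences of the Hilbert function of `L / N` along the degrees of the forms in `l`
eventually depend only on the total degree. -/
lemma eventuallyAntidiagConst_iterFwdDiff [Fintype σ] (d : MvPolynomial (σ ⊕ σ) k → ℕ)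
    (l : List (MvPolynomial (σ ⊕ σ) k)) (hl : ∀ f ∈ l, f ∈ 𝓑 (d f, d f))
    (hL : L.IsHomogeneous 𝓑) (hN : N.IsHomogeneous 𝓑) (hNL : N ≤ L)
    (K : Ideal (MvPolynomial (σ ⊕ σ) k)) (hK : K * L ≤ N)
    (hJ : minorIdeal k σ ≤ (K ⊔ Ideal.span {f | f ∈ l}).radical) :
    EventuallyAntidiagConst
      (iterFwdDiff ((l.map d).map fun d => (d, d)) (hilbertFn L - hilbertFn N)) := by
  induction l generalizing L N K with
  | nil =>
    simp only [List.not_mem_nil, Set.ofPred_false, Ideal.span_empty, sup_bot_eq] at hJ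
    obtain ⟨m, hm⟩ := Ideal.exists_pow_le_of_le_radical_of_fg hJ (IsNoetherian.noetherian _)
    exact eventuallyAntidiagConst_of_minorIdeal_pow_mul_le m hL hN hNL
      ((Ideal.mul_mono_left hm).trans hK)
  | cons f l ih =>
    have hf : f ∈ 𝓑 (d f, d f) := hl f (by simp)
    have hl' : ∀ g ∈ l, g ∈ 𝓑 (d g, d g) := fun g hg => hl g (by simp [hg])
    have hspan : K ⊔ Ideal.span {g | g ∈ f :: l} =
        (K ⊔ Ideal.span {f}) ⊔ Ideal.span {g | g ∈ l} := by
      rw [sup_assoc, ← Ideal.span_union]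
      congr 2
      ext g
      simp
    rw [hspan] at hJ
    have h1 := ih hl' hL (span_singleton_mul_sup_isHomogeneous hL hN hf)
      (sup_le Ideal.mul_le_right hNL) (K ⊔ Ideal.span {f}) (by
        rw [Ideal.sup_mul, sup_comm]
        exact sup_le_sup_left hK _) hJ
    have h2 := ih hl' (mulKer_isHomogeneous hL hN hf) hN (le_mulKer hNL f)
      (K ⊔ Ideal.span {f}) (by
        rw [Ideal.sup_mul]
        exact sup_le ((Ideal.mul_mono_right inf_le_left).trans hK)
          (span_singleton_mul_mulKer_le f)) hJ
    have key : fwdDiff (d f, d f) (hilbertFn L - hilbertFn N) =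
        (fun u => (hilbertFn L - hilbertFn (Ideal.span {f} * L ⊔ N)) (u + (d f, d f))) -
          (hilbertFn (mulKer L N f) - hilbertFn N) := by
      ext u
      have := hilbertFn_sub_mulKer hL hN hf u
      simp only [fwdDiff, Pi.sub_apply]
      omega
    simp only [List.map_cons, iterFwdDiff]
    rw [key, iterFwdDiff_sub, iterFwdDiff_shift]
    exact (h1.shift _).sub h2

end Minors

/-- Fewer than `2 n - 1` forms of bidegrees `(d, d)` do not cut out the diagonal. -/
lemma not_minorIdeal_le_radical [Fintype σ] (n : ℕ) (hn : 1 ≤ n) (hσ : Fintype.card σ = n + 1)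
    (d : MvPolynomial (σ ⊕ σ) k → ℕ) (l : List (MvPolynomial (σ ⊕ σ) k))
    (hl : ∀ f ∈ l, f ∈ 𝓑 (d f, d f)) (hd : ∀ f ∈ l, 1 ≤ d f) (hlen : l.length ≤ 2 * n - 2) :
    ¬ minorIdeal k σ ≤ (Ideal.span {f | f ∈ l}).radical := by
  intro hJ
  have h := eventuallyAntidiagConst_iterFwdDiff d l hl (Ideal.IsHomogeneous.top 𝓑)
    (Ideal.IsHomogeneous.bot 𝓑) bot_le ⊥ (by simp) (by simpa using hJ)
  rw [hilbertFn_bot, sub_zero, funext (hilbertFn_top n hσ)] at h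
  exact not_eventuallyAntidiagConst_iterFwdDiff n hn _ (by simpa using hd) (by simpa using hlen) h

end HilbertFunction

section Segre

variable {k : Type*} [Field k] {n : ℕ}

/-- The minor `x_i y_j - x_j y_i`, as an element of the Segre ring. -/
noncomputable def segreMinor (k : Type*) [Field k] {n : ℕ} (i j : Fin (n + 1)) :
    segreCoordRing k n :=
  ⟨segX i * segY j - segX j * segY i, sub_mem
    (Algebra.subset_adjoin ⟨(i, j), rfl⟩) (Algebra.subset_adjoin ⟨(j, i), rfl⟩)⟩

lemma coe_segreMinor (i j : Fin (n + 1)) :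
    (segreMinor k i j : MvPolynomial (Fin (n + 1) ⊕ Fin (n + 1)) k) =
      segX i * segY j - segX j * segY i := rfl

lemma segreMinor_self (i : Fin (n + 1)) : segreMinor k i i = 0 :=
  Subtype.ext (sub_self _)

lemma segreMinor_swap (i j : Fin (n + 1)) : segreMinor k j i = -segreMinor k i j :=
  Subtype.ext (neg_sub _ _).symm

/-- The Plücker relation. -/
lemma segreMinor_mul_segreMinor (i j a b : Fin (n + 1)) :
    segreMinor k i j * segreMinor k a b =
      segreMinor k i a * segreMinor k j b - segreMinor k i b * segreMinor k j a := by
  apply Subtype.ext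
  push_cast [coe_segreMinor]
  ring

lemma segreMinor_mem_diagonalIdeal {i j : Fin (n + 1)} (h : i < j) :
    segreMinor k i j ∈ diagonalIdeal k n :=
  Ideal.subset_span ⟨i, j, h, rfl⟩

lemma diagonalIdeal_le_iff {K : Ideal (segreCoordRing k n)} :
    diagonalIdeal k n ≤ K ↔ ∀ i j : Fin (n + 1), i < j → segreMinor k i j ∈ K := by
  refine ⟨fun h i j hij => h (segreMinor_mem_diagonalIdeal hij), fun h => ?_⟩
  refine Ideal.span_le.2 ?_
  rintro a ⟨i, j, hij, ha⟩
  rw [show a = segreMinor k i j from Subtype.ext ha]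
  exact h i j hij

/-- The sum of the minors `x_i y_j - x_j y_i` with `i < j` and `i + j = s`. -/
noncomputable def segreMinorSum (k : Type*) [Field k] (n s : ℕ) : segreCoordRing k n :=
  ∑ p : Fin (n + 1) × Fin (n + 1) with p.1 < p.2 ∧ (p.1 : ℕ) + p.2 = s, segreMinor k p.1 p.2

lemma isHomogeneous_segreMinorSum (s : ℕ) :
    (segreMinorSum k n s : MvPolynomial (Fin (n + 1) ⊕ Fin (n + 1)) k).IsHomogeneous 2 := by
  rw [segreMinorSum, AddSubmonoidClass.coe_finsetSum]
  exact IsHomogeneous.sum _ _ _ fun p _ =>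
    ((isHomogeneous_X k _).mul (isHomogeneous_X k _)).sub
      ((isHomogeneous_X k _).mul (isHomogeneous_X k _))

lemma segreMinorSum_mem_diagonalIdeal (s : ℕ) : segreMinorSum k n s ∈ diagonalIdeal k n :=
  Ideal.sum_mem _ fun _ hp => segreMinor_mem_diagonalIdeal (Finset.mem_filter.1 hp).2.1

/-- A radical ideal containing the sums of the minors along the antidiagonals contains the
minors. -/
lemma segreMinor_mem_of_segreMinorSum_mem {K : Ideal (segreCoordRing k n)} (hK : K.IsRadical)
    (h : ∀ s, 1 ≤ s → s ≤ 2 * n - 1 → segreMinorSum k n s ∈ K) (s : ℕ) :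
    ∀ i j : Fin (n + 1), (i : ℕ) + j = s → segreMinor k i j ∈ K := by
  induction s using Nat.strong_induction_on with
  | _ s ih =>
  have lower : ∀ i j : Fin (n + 1), i < j → (i : ℕ) + j = s → segreMinor k i j ∈ K := by
    intro i j hij hs
    have hij' : (i : ℕ) < j := hij
    have hmem := h s (by omega) (by omega)
    refine hK ⟨2, ?_⟩
    have hsum := K.mul_mem_left (segreMinor k i j) hmem
    rw [segreMinorSum, Finset.mul_sum, ← Finset.add_sum_erase _ _
      (Finset.mem_filter.2 ⟨Finset.mem_univ (i, j), hij, hs⟩), ← pow_two] at hsum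
    refine (Ideal.add_mem_iff_left _ (Ideal.sum_mem _ ?_)).1 hsum
    rintro ⟨a, b⟩ hab
    simp only [Finset.mem_erase, Finset.mem_filter, Finset.mem_univ, true_and, ne_eq,
      Prod.mk.injEq, not_and, Fin.ext_iff, Fin.lt_def] at hab
    obtain ⟨hne, hlt, hs'⟩ := hab
    rw [segreMinor_mul_segreMinor]
    have hia : segreMinor k i a ∈ K := ih (i + a) (by omega) i a rfl
    refine sub_mem (K.mul_mem_right _ hia) ?_
    rcases lt_or_ge (i : ℕ) a with hlt' | hge
    · exact K.mul_mem_right _ (ih (i + b) (by omega) i b rfl)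
    · exact K.mul_mem_left _ (ih (j + a) (by omega) j a rfl)
  intro i j hs
  rcases lt_trichotomy i j with hij | rfl | hij
  · exact lower i j hij hs
  · rw [segreMinor_self]
    exact K.zero_mem
  · rw [segreMinor_swap]
    exact K.neg_mem (lower j i hij (by omega))

lemma radical_span_segreMinorSum :
    (Ideal.span (Set.range fun s : Fin (2 * n - 1) => segreMinorSum k n (s + 1))).radical =
      (diagonalIdeal k n).radical := by
  refine le_antisymm (Ideal.radical_mono (Ideal.span_le.2 ?_))
    (Ideal.radical_le_radical_iff.2 (diagonalIdeal_le_iff.2 fun i j _ => ?_))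
  · rintro _ ⟨s, rfl⟩
    exact segreMinorSum_mem_diagonalIdeal _
  · refine segreMinor_mem_of_segreMinorSum_mem (Ideal.radical_isRadical _) (fun s h1 h2 => ?_)
      _ i j rfl
    refine Ideal.le_radical (Ideal.subset_span ⟨⟨s - 1, by omega⟩, ?_⟩)
    simp only
    rw [Nat.sub_add_cancel h1]

/-- The monomials of the elements of the Segre ring have the same degree in the variables `x_i` and
in the variables `y_j`. -/
lemma sum_inl_eq_sum_inr_of_mem_segreCoordRing
    {p : MvPolynomial (Fin (n + 1) ⊕ Fin (n + 1)) k} (hp : p ∈ segreCoordRing k n)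
    {m : Fin (n + 1) ⊕ Fin (n + 1) →₀ ℕ} (hm : coeff m p ≠ 0) :
    ∑ i, m (Sum.inl i) = ∑ i, m (Sum.inr i) := by
  classical
  induction hp using Algebra.adjoin_induction generalizing m with
  | mem x hx =>
    obtain ⟨⟨i, j⟩, rfl⟩ := hx
    have hX : segX i * segY j ∈ bihomogeneousSubmodule k (Fin (n + 1)) ((1, 0) + (0, 1)) :=
      SetLike.mul_mem_graded (X_inl_mem i) (X_inr_mem j)
    have := hX hm
    rw [weight_bidegree, Prod.ext_iff] at this
    simp only [Prod.fst_add, Prod.snd_add] at this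
    omega
  | algebraMap r =>
    rw [algebraMap_eq, coeff_C] at hm
    have : m = 0 := by by_contra h; exact hm (if_neg (Ne.symm h))
    simp [this]
  | add x y _ _ hx hy =>
    rw [coeff_add] at hm
    by_cases h : coeff m x = 0
    · exact hy (by simpa [h] using hm)
    · exact hx h
  | mul x y _ _ hx hy =>
    rw [coeff_mul] at hm
    obtain ⟨⟨a, b⟩, hab, hne⟩ := Finset.exists_ne_zero_of_sum_ne_zero hm
    have ha := hx (left_ne_zero_of_mul hne)
    have hb := hy (right_ne_zero_of_mul hne)
    rw [← Finset.HasAntidiagonal.mem_antidiagonal.1 hab]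
    simp [Finset.sum_add_distrib, ha, hb]

lemma mem_bihomogeneousSubmodule_of_isHomogeneous
    {p : MvPolynomial (Fin (n + 1) ⊕ Fin (n + 1)) k} (hp : p ∈ segreCoordRing k n) {e : ℕ}
    (he : p.IsHomogeneous e) : p ∈ bihomogeneousSubmodule k (Fin (n + 1)) (e / 2, e / 2) := by
  intro m hm
  have h1 := sum_inl_eq_sum_inr_of_mem_segreCoordRing hp hm
  have h2 : m.degree = e := by
    rw [Finsupp.degree_eq_weight_one]
    exact he hm
  rw [Finsupp.degree_eq_sum, Fintype.sum_sum_type] at h2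
  rw [weight_bidegree, Prod.mk.injEq]
  omega

lemma constantCoeff_eq_zero_of_mem_radical_diagonalIdeal {a : segreCoordRing k n}
    (ha : a ∈ (diagonalIdeal k n).radical) :
    constantCoeff (a : MvPolynomial (Fin (n + 1) ⊕ Fin (n + 1)) k) = 0 := by
  let φ : segreCoordRing k n →+* k := constantCoeff.comp (segreCoordRing k n).val.toRingHom
  have h : (diagonalIdeal k n).radical ≤ RingHom.ker φ :=
    (RingHom.ker_isPrime φ).isRadical.radical_le_iff.2 <| diagonalIdeal_le_iff.2 fun i j _ => by
      simp [φ, RingHom.mem_ker, coe_segreMinor]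
  exact h ha

lemma exists_mem_bihomogeneousSubmodule {a : segreCoordRing k n}
    (ha : a ∈ (diagonalIdeal k n).radical) {e : ℕ}
    (he : (a : MvPolynomial (Fin (n + 1) ⊕ Fin (n + 1)) k).IsHomogeneous e) :
    ∃ d, 1 ≤ d ∧ (a : MvPolynomial (Fin (n + 1) ⊕ Fin (n + 1)) k) ∈
      bihomogeneousSubmodule k (Fin (n + 1)) (d, d) := by
  have hmem := mem_bihomogeneousSubmodule_of_isHomogeneous a.2 he
  rcases Nat.eq_zero_or_pos (e / 2) with h0 | hpos
  · refine ⟨1, le_rfl, ?_⟩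
    have : (a : MvPolynomial (Fin (n + 1) ⊕ Fin (n + 1)) k) = 0 := by
      ext m
      rw [coeff_zero]
      by_contra hm
      have hw := hmem hm
      rw [weight_bidegree, h0, Prod.mk.injEq, Finset.sum_eq_zero_iff, Finset.sum_eq_zero_iff] at hw
      have : m = 0 := by
        ext (i | i)
        · exact hw.1 i (Finset.mem_univ i)
        · exact hw.2 i (Finset.mem_univ i)
      subst this
      exact hm (constantCoeff_eq_zero_of_mem_radical_diagonalIdeal ha)
    rw [this]
    exact Submodule.zero_mem _
  · exact ⟨e / 2, hpos, hmem⟩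

lemma minorIdeal_le_radical_span {t : ℕ} {f : Fin t → segreCoordRing k n}
    (hf : diagonalIdeal k n ≤ (Ideal.span (Set.range f)).radical) :
    minorIdeal k (Fin (n + 1)) ≤ (Ideal.span {g | g ∈ List.ofFn fun i =>
      (f i : MvPolynomial (Fin (n + 1) ⊕ Fin (n + 1)) k)}).radical := by
  set R := (Ideal.span {g | g ∈ List.ofFn fun i =>
      (f i : MvPolynomial (Fin (n + 1) ⊕ Fin (n + 1)) k)}).radical with hR
  have hcomap : diagonalIdeal k n ≤ R.comap (segreCoordRing k n).val := by
    rw [hR, Ideal.comap_radical]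
    refine hf.trans (Ideal.radical_mono (Ideal.span_le.2 ?_))
    rintro _ ⟨i, rfl⟩
    exact Ideal.subset_span (by simp)
  have hlt : ∀ i j : Fin (n + 1), i < j → (segX i * segY j - segX j * segY i :
      MvPolynomial (Fin (n + 1) ⊕ Fin (n + 1)) k) ∈ R :=
    diagonalIdeal_le_iff.1 hcomap
  refine Ideal.span_le.2 ?_
  rintro _ ⟨⟨i, j⟩, rfl⟩
  rcases lt_trichotomy i j with hij | rfl | hij
  · exact hlt i j hij
  · simp
  · simpa using R.neg_mem (hlt j i hij)

lemma le_of_radical_span_eq_radical_diagonalIdeal (hn : 1 ≤ n) {t : ℕ}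
    (f : Fin t → segreCoordRing k n)
    (hf : ∀ i, ∃ e, (f i : MvPolynomial (Fin (n + 1) ⊕ Fin (n + 1)) k).IsHomogeneous e)
    (hrad : (Ideal.span (Set.range f)).radical = (diagonalIdeal k n).radical) :
    2 * n - 1 ≤ t := by
  by_contra! ht
  have hbi : ∀ g ∈ List.ofFn fun i => (f i : MvPolynomial (Fin (n + 1) ⊕ Fin (n + 1)) k),
      ∃ d, 1 ≤ d ∧ g ∈ bihomogeneousSubmodule k (Fin (n + 1)) (d, d) := by
    intro g hg
    obtain ⟨i, rfl⟩ := List.mem_ofFn.1 hg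
    obtain ⟨e, he⟩ := hf i
    exact exists_mem_bihomogeneousSubmodule
      (hrad ▸ Ideal.le_radical (Ideal.subset_span ⟨i, rfl⟩)) he
  choose! d hd using hbi
  exact not_minorIdeal_le_radical n hn (by simp) d _ (fun g hg => (hd g hg).2)
    (fun g hg => (hd g hg).1) (by simp only [List.length_ofFn]; omega)
    (minorIdeal_le_radical_span (hrad ▸ Ideal.le_radical))

end Segre

theorem araH_diagonal_of_segre (k : Type*) [Field k] [IsSepClosed k] (n : ℕ) (hn : 1 ≤ n) :
    araHsub (diagonalIdeal k n) = 2*n - 1 := by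
  have hmem : 2 * n - 1 ∈ {t | ∃ f : Fin t → segreCoordRing k n,
      (∀ i, ∃ d, ((f i : MvPolynomial (Fin (n+1) ⊕ Fin (n+1)) k)).IsHomogeneous d) ∧
      (Ideal.span (Set.range f)).radical = (diagonalIdeal k n).radical} :=
    ⟨fun s => segreMinorSum k n (s + 1), fun _ => ⟨2, isHomogeneous_segreMinorSum _⟩,
      radical_span_segreMinorSum⟩
  refine le_antisymm (Nat.sInf_le hmem) (le_csInf ⟨_, hmem⟩ ?_)
  rintro t ⟨f, hf, hrad⟩
  exact le_of_radical_span_eq_radical_diagonalIdeal hn f hf hrad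
end

section
/- Let X = V_+(F) ⊆ P^n be a hypersurface over a field k such that there exists a line L ⊆ P^n meeting X only at one point P, and let I ⊆ P = k[z_{ij} : 0 ≤ i ≤ n, j = 0,1] be the ideal defining the Segre product X × P^1 ⊆ P^{2n+1}. Then ara_h(I) ≤ 2n. More precisely, after a change of coordinates so that L = V_+((x_0,…,x_{n−2})), setting [i,j] = z_{i0}z_{j1} − z_{j0}z_{i1}, F_0 = F(z_{00},…,z_{n0}), F_1 = F(z_{01},…,z_{n1}), and h_t = Σ_{i<j, i+j=t}[i,j] for t = 1,…,2n−2, one has √I = √((h_1,…,h_{2n−2}, F_0, F_1)). -/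
/-!
STATEMENT 7: Let `X = V₊(F) ⊆ ℙⁿ` be a hypersurface over a field `k` such that there
exists a line `L ⊆ ℙⁿ` meeting `X` only at one point `P`, and let
`I ⊆ P = k[z_{ij} : 0 ≤ i ≤ n, j = 0,1]` be the ideal defining the Segre product
`X × ℙ¹ ⊆ ℙ^{2n+1}`.  Then `ara_h(I) ≤ 2n`.  More precisely, after a change of coordinates
so that `L = V₊((x₀,…,x_{n−2}))`, setting `[i,j] = z_{i0}z_{j1} − z_{j0}z_{i1}`,
`F₀ = F(z₀₀,…,z_{n0})`, `F₁ = F(z₀₁,…,z_{n1})`, and `h_t = Σ_{i<j, i+j=t}[i,j]` for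
`t = 1,…,2n−2`, one has `√I = √((h₁,…,h_{2n−2}, F₀, F₁))`.

The line `L` is encoded by two `k`-linearly independent vectors `v, w` of `k^{n+1}`;
"`L` meets `X` only at `P`" means that the set of closed points of `L ∩ X` over the
algebraic closure `K` of `k` is exactly `{P}`, where the point `P` is encoded by a
nonzero vector `p` of `K^{n+1}` lying on (the base change of) `L`.
-/

open MvPolynomial

/-- The ideal of `P = k[z_{ij}]` defining the Segre product
`V₊(a) × V₊(b) ⊆ ℙ^{nm+n+m}`: the kernel of the map `z_{ij} ↦ x_i y_j (mod a,b)`. -/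
noncomputable def segreIdeal (k : Type*) [Field k] (n m : ℕ)
    (a : Ideal (MvPolynomial (Fin (n+1)) k)) (b : Ideal (MvPolynomial (Fin (m+1)) k)) :
    Ideal (MvPolynomial (Fin (n+1) × Fin (m+1)) k) :=
  RingHom.ker (MvPolynomial.aeval (R := k) (fun p : Fin (n+1) × Fin (m+1) =>
    Ideal.Quotient.mk
      (a.map (MvPolynomial.rename (Sum.inl : Fin (n+1) → Fin (n+1) ⊕ Fin (m+1)))
        ⊔ b.map (MvPolynomial.rename (Sum.inr : Fin (m+1) → Fin (n+1) ⊕ Fin (m+1))))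
      (X (Sum.inl p.1) * X (Sum.inr p.2))))

/-- homogeneous arithmetical rank -/
noncomputable def araH {k : Type*} [CommRing k] {σ : Type*} (I : Ideal (MvPolynomial σ k)) : ℕ :=
  sInf {t | ∃ f : Fin t → MvPolynomial σ k, (∀ i, ∃ d, (f i).IsHomogeneous d) ∧
    (Ideal.span (Set.range f)).radical = I.radical}

/-- the 2-minor `[i,j] = z_{i0} z_{j1} - z_{j0} z_{i1}` -/
noncomputable def minor {k : Type*} [Field k] {n : ℕ} (i j : Fin (n+1)) :
    MvPolynomial (Fin (n+1) × Fin 2) k :=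
  X (i, 0) * X (j, 1) - X (j, 0) * X (i, 1)

/-- `h_t = Σ_{i<j, i+j=t} [i,j]` -/
noncomputable def hPoly {k : Type*} [Field k] {n : ℕ} (t : ℕ) :
    MvPolynomial (Fin (n+1) × Fin 2) k :=
  ∑ p ∈ Finset.univ.filter
      (fun p : Fin (n+1) × Fin (n+1) => p.1 < p.2 ∧ (p.1 : ℕ) + (p.2 : ℕ) = t),
    minor p.1 p.2

/-- `F` evaluated on the `j`-th column of the matrix `(z_{ij})` -/
noncomputable def colSubst {k : Type*} [Field k] {n : ℕ} (j : Fin 2)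
    (F : MvPolynomial (Fin (n+1)) k) : MvPolynomial (Fin (n+1) × Fin 2) k :=
  MvPolynomial.aeval (fun i : Fin (n+1) => X (i, j)) F

theorem aeval_mul_right_of_isHomogeneous {σ k A : Type*} [CommSemiring k]
    [CommSemiring A] [Algebra k A] {F : MvPolynomial σ k} {d : ℕ} (hF : F.IsHomogeneous d)
    (x : σ → A) (y : A) : aeval (fun i => x i * y) F = aeval x F * y ^ d := by
  rw [aeval_def, aeval_def, eval₂_eq, eval₂_eq, Finset.sum_mul]
  refine Finset.sum_congr rfl fun m hm => ?_
  have hdeg : ∑ i ∈ m.support, m i = d := by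
    rw [← hF.degree_eq_sum_deg_support hm]
  simp_rw [mul_pow, Finset.prod_mul_distrib, Finset.prod_pow_eq_pow_sum, hdeg, mul_assoc]

/-- Two vectors all of whose antidiagonal sums of `2 × 2` minors, except possibly the last one,
vanish are either proportional or supported on the last two coordinates. -/
theorem minors_eq_zero_or_supported_of_antidiagonal_sums_eq_zero {K : Type*} [Field K] {n : ℕ}
    (a b : Fin (n + 1) → K)
    (h : ∀ t : ℕ, 1 ≤ t → t ≤ 2 * n - 2 →
      ∑ p ∈ Finset.univ.filter
        (fun p : Fin (n + 1) × Fin (n + 1) => p.1 < p.2 ∧ (p.1 : ℕ) + (p.2 : ℕ) = t),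
        (a p.1 * b p.2 - a p.2 * b p.1) = 0) :
    (∀ i j, a i * b j = a j * b i) ∨ ∀ i : Fin (n + 1), (i : ℕ) < n - 1 → a i = 0 ∧ b i = 0 := by
  have zero_below : ∀ t : ℕ, t ≤ 2 * n - 2 → ∀ i j : Fin (n + 1), i < j → (i : ℕ) + j = t →
      a i * b j - a j * b i = 0 := by
    intro t
    induction t using Nat.strong_induction_on with
    | _ t ih =>
      intro ht i j hij hsum
      have hsum_zero := h t (by have : (i : ℕ) < j := hij; omega) ht
      by_contra hne
      apply hne
      rw [← hsum_zero]
      symm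
      refine Finset.sum_eq_single_of_mem (i, j) (by simp [hij, hsum]) ?_
      rintro ⟨i', j'⟩ hmem hdiff
      simp only [Finset.mem_filter, Finset.mem_univ, true_and] at hmem
      obtain ⟨hij', hsum'⟩ := hmem
      have hij₁ : (i : ℕ) < j := hij
      have hij₂ : (i' : ℕ) < j' := hij'
      have hii : (i : ℕ) ≠ i' := by
        intro hii
        apply hdiff
        ext <;> simp <;> omega
      have vanish : ∀ p q : Fin (n + 1), p < q → (p : ℕ) + q < t → a p * b q - a q * b p = 0 :=
        fun p q hpq hlt => ih _ hlt (by omega) p q hpq rfl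
      have key : (a i * b j - a j * b i) * (a i' * b j' - a j' * b i') = 0 := by
        rcases lt_or_gt_of_ne hii with hlt | hlt
        · have h₁ := vanish i i' hlt (by omega)
          have h₂ := vanish i j' (by change (i : ℕ) < j'; omega) (by omega)
          linear_combination (a j * b j' - a j' * b j) * h₁ + (a i' * b j - a j * b i') * h₂
        · have h₁ := vanish i' i hlt (by omega)
          have h₂ := vanish i' j (by change (i' : ℕ) < j; omega) (by omega)
          linear_combination (a j' * b j - a j * b j') * h₁ + (a i * b j' - a j' * b i) * h₂
      exact (mul_eq_zero.mp key).resolve_left hne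
  have zero_of_lt : ∀ i j : Fin (n + 1), i < j → (i : ℕ) < n - 1 → a i * b j - a j * b i = 0 := by
    intro i j hij hi
    have := j.isLt
    exact zero_below _ (by omega) i j hij rfl
  by_cases hlast : ∀ i j : Fin (n + 1), i < j → a i * b j - a j * b i = 0
  · left
    intro i j
    rcases lt_trichotomy i j with hij | rfl | hij
    · exact sub_eq_zero.mp (hlast i j hij)
    · rfl
    · exact (sub_eq_zero.mp (hlast j i hij)).symm
  · right
    push Not at hlast
    obtain ⟨p, q, hpq, hne⟩ := hlast
    have hp : ¬ (p : ℕ) < n - 1 := fun hp => hne (zero_of_lt p q hpq hp)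
    have hpq' : (p : ℕ) < q := hpq
    intro i hi
    have h₁ := zero_of_lt i p (by change (i : ℕ) < p; omega) hi
    have h₂ := zero_of_lt i q (by change (i : ℕ) < q; omega) hi
    constructor
    · refine (mul_eq_zero.mp ?_).resolve_right hne
      linear_combination a p * h₂ - a q * h₁
    · refine (mul_eq_zero.mp ?_).resolve_right hne
      linear_combination b p * h₂ - b q * h₁

/-- Two linearly independent families with the same finite index type are related by a linear
automorphism. -/
theorem exists_linearEquiv_of_linearIndependent {k V : Type*} [Field k] [AddCommGroup V]
    [Module k V] [FiniteDimensional k V] {ι : Type*} [Finite ι] {u v : ι → V}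
    (hu : LinearIndependent k u) (hv : LinearIndependent k v) :
    ∃ e : V ≃ₗ[k] V, ∀ i, e (u i) = v i := by
  obtain ⟨e, he⟩ := Submodule.exists_linearEquiv_restrict_eq
    ((Module.Basis.span hu).equiv (Module.Basis.span hv) (Equiv.refl ι))
  refine ⟨e, fun i => ?_⟩
  have hi := he (Module.Basis.span hu i)
  rw [Module.Basis.equiv_apply, Equiv.refl_apply, Module.Basis.span_apply,
    Module.Basis.span_apply] at hi
  exact hi.symm

theorem aeval_eq_zero_of_mem_segreIdeal {k A : Type*} [Field k] [CommRing A] [Algebra k A]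
    {n m : ℕ} {a : Ideal (MvPolynomial (Fin (n + 1)) k)}
    {b : Ideal (MvPolynomial (Fin (m + 1)) k)} {x : Fin (n + 1) → A} {y : Fin (m + 1) → A}
    (hx : ∀ f ∈ a, aeval x f = 0) (hy : ∀ g ∈ b, aeval y g = 0)
    {f : MvPolynomial (Fin (n + 1) × Fin (m + 1)) k} (hf : f ∈ segreIdeal k n m a b) :
    aeval (fun q : Fin (n + 1) × Fin (m + 1) => x q.1 * y q.2) f = 0 := by
  set I := a.map (rename (R := k) (Sum.inl : Fin (n + 1) → Fin (n + 1) ⊕ Fin (m + 1)))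
    ⊔ b.map (rename (R := k) (Sum.inr : Fin (m + 1) → Fin (n + 1) ⊕ Fin (m + 1))) with hI
  have hker : I ≤ RingHom.ker (aeval (R := k) (Sum.elim x y)) := by
    rw [hI, sup_le_iff, Ideal.map_le_iff_le_comap, Ideal.map_le_iff_le_comap]
    constructor
    · intro g hg
      simpa [Ideal.mem_comap, RingHom.mem_ker, aeval_rename] using hx g hg
    · intro g hg
      simpa [Ideal.mem_comap, RingHom.mem_ker, aeval_rename] using hy g hg
  let φ : (MvPolynomial (Fin (n + 1) ⊕ Fin (m + 1)) k ⧸ I) →ₐ[k] A :=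
    Ideal.Quotient.liftₐ I (aeval (R := k) (Sum.elim x y)) fun g hg => hker hg
  have hf' : aeval (R := k) (fun q : Fin (n + 1) × Fin (m + 1) =>
      Ideal.Quotient.mk I (X (Sum.inl q.1) * X (Sum.inr q.2))) f = 0 := hf
  have hcomp := congrArg φ hf'
  rw [map_zero, ← AlgHom.comp_apply, comp_aeval] at hcomp
  have hφ : ∀ g, φ (Ideal.Quotient.mk I g) = aeval (Sum.elim x y) g := fun _ => rfl
  simpa [hφ] using hcomp

/-- A polynomial vanishing at all rank one matrices `x yᵀ` with `x` a zero of `F`, with values in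
arbitrary commutative algebras, belongs to the ideal of the Segre product. -/
theorem mem_segreIdeal_span_singleton_of_forall.{u} {k : Type u} [Field k] {n m : ℕ}
    {F : MvPolynomial (Fin (n + 1)) k} {b : Ideal (MvPolynomial (Fin (m + 1)) k)}
    {f : MvPolynomial (Fin (n + 1) × Fin (m + 1)) k}
    (hf : ∀ {A : Type u} [CommRing A] [Algebra k A] (x : Fin (n + 1) → A) (y : Fin (m + 1) → A),
      aeval x F = 0 → aeval (fun q : Fin (n + 1) × Fin (m + 1) => x q.1 * y q.2) f = 0) :
    f ∈ segreIdeal k n m (Ideal.span {F}) b := by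
  rw [segreIdeal, RingHom.mem_ker]
  set I := (Ideal.span {F}).map
      (rename (R := k) (Sum.inl : Fin (n + 1) → Fin (n + 1) ⊕ Fin (m + 1)))
    ⊔ b.map (rename (R := k) (Sum.inr : Fin (m + 1) → Fin (n + 1) ⊕ Fin (m + 1))) with hI
  have hF : aeval (R := k) (fun i : Fin (n + 1) =>
      Ideal.Quotient.mk I (X (Sum.inl i))) F = 0 := by
    have hmem : rename (Sum.inl : Fin (n + 1) → Fin (n + 1) ⊕ Fin (m + 1)) F ∈ I :=
      Ideal.mem_sup_left (Ideal.mem_map_of_mem _ (Ideal.subset_span rfl))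
    have hzero : Ideal.Quotient.mkₐ k I (rename Sum.inl F) = 0 :=
      Ideal.Quotient.eq_zero_iff_mem.mpr hmem
    rw [rename_eq_aeval, ← AlgHom.comp_apply, comp_aeval] at hzero
    exact hzero
  simpa only [map_mul] using
    hf _ (fun j => Ideal.Quotient.mk I (X (Sum.inr j))) hF

/-- The `k`-algebra endomorphism replacing the generic matrix `(z_{ij})` by `M (z_{ij})`. -/
noncomputable def rowSubst {k : Type*} [Field k] {n : ℕ}
    (M : Matrix (Fin (n + 1)) (Fin (n + 1)) k) :
    MvPolynomial (Fin (n + 1) × Fin 2) k →ₐ[k] MvPolynomial (Fin (n + 1) × Fin 2) k :=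
  aeval fun q => ∑ l, C (M q.1 l) * X (l, q.2)

theorem aeval_rowSubst {k A : Type*} [Field k] [CommRing A] [Algebra k A] {n : ℕ}
    (M : Matrix (Fin (n + 1)) (Fin (n + 1)) k) (z : Fin (n + 1) × Fin 2 → A)
    (f : MvPolynomial (Fin (n + 1) × Fin 2) k) :
    aeval z (rowSubst M f) =
      aeval (fun q => (M.map (algebraMap k A)).mulVec (fun l => z (l, q.2)) q.1) f := by
  rw [rowSubst, ← AlgHom.comp_apply, comp_aeval]
  congr 2
  ext q
  simp [Matrix.mulVec, dotProduct]

theorem rowSubst_one {k : Type*} [Field k] {n : ℕ} (f : MvPolynomial (Fin (n + 1) × Fin 2) k) :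
    rowSubst 1 f = f := by
  rw [rowSubst]
  convert aeval_X_left_apply f using 3 with q
  simp [Matrix.one_apply]

theorem aeval_hPoly {k A : Type*} [Field k] [CommRing A] [Algebra k A] {n : ℕ}
    (z : Fin (n + 1) × Fin 2 → A) (t : ℕ) :
    aeval z (hPoly (k := k) (n := n) t) = ∑ p ∈ Finset.univ.filter
      (fun p : Fin (n + 1) × Fin (n + 1) => p.1 < p.2 ∧ (p.1 : ℕ) + (p.2 : ℕ) = t),
      (z (p.1, 0) * z (p.2, 1) - z (p.2, 0) * z (p.1, 1)) := by
  simp [hPoly, minor]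

theorem aeval_colSubst {k A : Type*} [Field k] [CommRing A] [Algebra k A] {n : ℕ}
    (z : Fin (n + 1) × Fin 2 → A) (j : Fin 2) (F : MvPolynomial (Fin (n + 1)) k) :
    aeval z (colSubst j F) = aeval (fun i => z (i, j)) F := by
  rw [colSubst, ← AlgHom.comp_apply, comp_aeval]
  simp

theorem isHomogeneous_colSubst {k : Type*} [Field k] {n d : ℕ} {F : MvPolynomial (Fin (n + 1)) k}
    (hF : F.IsHomogeneous d) (j : Fin 2) : (colSubst j F).IsHomogeneous (1 * d) :=
  hF.aeval _ fun _ => isHomogeneous_X _ _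

theorem isHomogeneous_hPoly {k : Type*} [Field k] {n : ℕ} (t : ℕ) :
    (hPoly (k := k) (n := n) t).IsHomogeneous 2 :=
  IsHomogeneous.sum _ _ _ fun _ _ =>
    ((isHomogeneous_X _ _).mul (isHomogeneous_X _ _)).sub
      ((isHomogeneous_X _ _).mul (isHomogeneous_X _ _))

theorem isHomogeneous_rowSubst {k : Type*} [Field k] {n d : ℕ}
    (M : Matrix (Fin (n + 1)) (Fin (n + 1)) k) {f : MvPolynomial (Fin (n + 1) × Fin 2) k}
    (hf : f.IsHomogeneous d) : (rowSubst M f).IsHomogeneous (1 * d) :=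
  hf.aeval _ fun _ => IsHomogeneous.sum _ _ _ fun l _ => by
    simpa using (isHomogeneous_C _ (M _ l)).mul (isHomogeneous_X k (l, _))

/-- The equations `F₀`, `F₁` together with the transforms of `h₁, …, h_{2n-2}` under the change of
coordinates given by the matrix `M`. -/
def segreEquations {k : Type*} [Field k] {n : ℕ} (M : Matrix (Fin (n + 1)) (Fin (n + 1)) k)
    (F : MvPolynomial (Fin (n + 1)) k) : Set (MvPolynomial (Fin (n + 1) × Fin 2) k) :=
  {colSubst 0 F, colSubst 1 F} ∪
    Set.range fun t : Fin (2 * n - 2) => rowSubst M (hPoly (k := k) (n := n) (t + 1))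

theorem span_segreEquations_le_segreIdeal {k : Type*} [Field k] {n d : ℕ}
    (M : Matrix (Fin (n + 1)) (Fin (n + 1)) k) {F : MvPolynomial (Fin (n + 1)) k}
    (hF : F.IsHomogeneous d) :
    Ideal.span (segreEquations M F) ≤ segreIdeal k n 1 (Ideal.span {F}) ⊥ := by
  have hcol : ∀ j, colSubst j F ∈ segreIdeal k n 1 (Ideal.span {F}) ⊥ := fun j =>
    mem_segreIdeal_span_singleton_of_forall fun x y hx => by
      rw [aeval_colSubst]
      exact (aeval_mul_right_of_isHomogeneous hF x (y j)).trans (by rw [hx, zero_mul])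
  rw [Ideal.span_le]
  rintro _ ((rfl | rfl) | ⟨t, rfl⟩)
  · exact hcol 0
  · exact hcol 1
  · refine mem_segreIdeal_span_singleton_of_forall fun {A} _ _ x y _ => ?_
    have hmul : ∀ j : Fin 2, (M.map (algebraMap k A)).mulVec (fun l => x l * y j) =
        fun i => (M.map (algebraMap k A)).mulVec x i * y j := fun j => by
      ext i
      simp [Matrix.mulVec, dotProduct, Finset.sum_mul, mul_assoc]
    rw [aeval_rowSubst, aeval_hPoly]
    refine Finset.sum_eq_zero fun p _ => ?_
    simp only [hmul]
    ring

theorem eq_zero_or_eq_smul_of_minors_eq_zero {K ι : Type*} [Field K] {a b : ι → K}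
    (h : ∀ i j, a i * b j = a j * b i) : a = 0 ∨ ∃ c : K, b = c • a := by
  by_cases ha : a = 0
  · exact .inl ha
  · obtain ⟨i, hi⟩ := Function.ne_iff.mp ha
    have hi' : a i ≠ 0 := hi
    refine .inr ⟨b i / a i, funext fun j => ?_⟩
    rw [Pi.smul_apply, smul_eq_mul]
    field_simp
    linear_combination h i j

/-- The equations `segreEquations M F` cut out the Segre product of `V₊(F)` with `ℙ¹`, as soon as
the zeros of `F` on the line given by the vanishing of the first `n - 1` coordinates of `M x` are
pairwise proportional. -/
theorem radical_span_segreEquations {k K : Type*} [Field k] [Field K] [Algebra k K]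
    [IsAlgClosed K] {n d : ℕ} {M N : Matrix (Fin (n + 1)) (Fin (n + 1)) k}
    (hNM : N * M = 1) {F : MvPolynomial (Fin (n + 1)) k} (hF : F.IsHomogeneous d)
    (hline : ∀ a b : Fin (n + 1) → K,
      (∀ i : Fin (n + 1), (i : ℕ) < n - 1 → (M.map (algebraMap k K)).mulVec a i = 0) →
      (∀ i : Fin (n + 1), (i : ℕ) < n - 1 → (M.map (algebraMap k K)).mulVec b i = 0) →
      aeval a F = 0 → aeval b F = 0 → ∀ i j, a i * b j = a j * b i) :
    (Ideal.span (segreEquations M F)).radical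
      = (segreIdeal k n 1 (Ideal.span {F}) ⊥).radical := by
  refine le_antisymm (Ideal.radical_mono (span_segreEquations_le_segreIdeal M hF)) ?_
  rw [← vanishingIdeal_zeroLocus_eq_radical (K := K),
    ← vanishingIdeal_zeroLocus_eq_radical (K := K)]
  refine vanishingIdeal_anti_mono fun z hz => ?_
  rw [zeroLocus_span] at hz
  have hcol : ∀ j : Fin 2, aeval (fun i => z (i, j)) F = 0 := by
    intro j
    rw [← aeval_colSubst]
    fin_cases j
    · exact hz _ (.inl (.inl rfl))
    · exact hz _ (.inl (.inr rfl))
  set a : Fin (n + 1) → K := fun i => z (i, 0) with ha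
  set b : Fin (n + 1) → K := fun i => z (i, 1) with hb
  have hprop : ∀ i j, a i * b j = a j * b i := by
    rcases minors_eq_zero_or_supported_of_antidiagonal_sums_eq_zero
      ((M.map (algebraMap k K)).mulVec a) ((M.map (algebraMap k K)).mulVec b) (fun t ht₁ ht₂ => by
        have ht := hz _ (.inr ⟨⟨t - 1, by omega⟩, rfl⟩)
        rw [aeval_rowSubst, aeval_hPoly] at ht
        simpa only [Nat.sub_add_cancel ht₁] using ht) with h | h
    · have hinv : ∀ c : Fin (n + 1) → K,
          (N.map (algebraMap k K)).mulVec ((M.map (algebraMap k K)).mulVec c) = c := fun c => by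
        rw [Matrix.mulVec_mulVec, ← Matrix.map_mul, hNM]
        simp
      rcases eq_zero_or_eq_smul_of_minors_eq_zero h with h | ⟨c, h⟩
      · have ha0 : a = 0 := by rw [← hinv a, h, Matrix.mulVec_zero]
        simp [ha0]
      · have hba : b = c • a := by rw [← hinv b, h, Matrix.mulVec_smul, hinv]
        intro i j
        simp only [hba, Pi.smul_apply, smul_eq_mul]
        ring
    · exact hline a b (fun i hi => (h i hi).1) (fun i hi => (h i hi).2) (hcol 0) (hcol 1)
  obtain ⟨x, y, hx, hxy⟩ : ∃ (x : Fin (n + 1) → K) (y : Fin 2 → K), aeval x F = 0 ∧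
      z = fun q : Fin (n + 1) × Fin 2 => x q.1 * y q.2 := by
    rcases eq_zero_or_eq_smul_of_minors_eq_zero hprop with h | ⟨c, h⟩
    · refine ⟨b, ![0, 1], hcol 1, ?_⟩
      ext ⟨i, j⟩
      fin_cases j
      · simpa using congrFun h i
      · simp [hb]
    · refine ⟨a, ![1, c], hcol 0, ?_⟩
      ext ⟨i, j⟩
      fin_cases j
      · simp [ha]
      · simpa [mul_comm] using congrFun h i
  rw [mem_zeroLocus_iff]
  intro f hf
  rw [hxy]
  refine aeval_eq_zero_of_mem_segreIdeal (fun g hg => ?_) (fun g hg => ?_) hf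
  · obtain ⟨c, rfl⟩ := Ideal.mem_span_singleton'.mp hg
    rw [map_mul, hx, mul_zero]
  · rw [Ideal.mem_bot.mp hg, map_zero]

theorem araH_segreIdeal_le_of_radical_eq {k : Type*} [Field k] {n d : ℕ} (hn : 1 ≤ n)
    (M : Matrix (Fin (n + 1)) (Fin (n + 1)) k) {F : MvPolynomial (Fin (n + 1)) k}
    (hF : F.IsHomogeneous d) {I : Ideal (MvPolynomial (Fin (n + 1) × Fin 2) k)}
    (h : (Ideal.span (segreEquations M F)).radical = I.radical) : araH I ≤ 2 * n := by
  let f : Fin 2 ⊕ Fin (2 * n - 2) → MvPolynomial (Fin (n + 1) × Fin 2) k :=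
    Sum.elim (fun j => colSubst j F) fun t => rowSubst M (hPoly (t + 1))
  let e : Fin (2 * n) ≃ Fin 2 ⊕ Fin (2 * n - 2) :=
    (finCongr (by omega : 2 * n = 2 + (2 * n - 2))).trans finSumFinEquiv.symm
  refine Nat.sInf_le ⟨f ∘ e, fun i => ?_, ?_⟩
  · change ∃ d, (f (e i)).IsHomogeneous d
    rcases e i with j | t
    · exact ⟨_, isHomogeneous_colSubst hF j⟩
    · exact ⟨_, isHomogeneous_rowSubst M (isHomogeneous_hPoly _)⟩
  · rw [← h, e.surjective.range_comp, Set.Sum.elim_range, segreEquations]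
    congr 3
    ext g
    simp [eq_comm]

/-- If two columns of `N` span a line meeting `V₊(F)` only at `p`, then the zeros of `F` on this
line are pairwise proportional. -/
theorem proportional_of_mem_line {k K : Type*} [Field k] [Field K] [Algebra k K] {n : ℕ}
    {F : MvPolynomial (Fin (n + 1)) k} {v w : Fin (n + 1) → k} {p : Fin (n + 1) → K}
    (hLX : ∀ a b : K, ¬(a = 0 ∧ b = 0) →
      eval (a • (algebraMap k K ∘ v) + b • (algebraMap k K ∘ w)) (F.map (algebraMap k K)) = 0 →
      ∃ c : K, a • (algebraMap k K ∘ v) + b • (algebraMap k K ∘ w) = c • p)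
    {M N : Matrix (Fin (n + 1)) (Fin (n + 1)) k} (hNM : N * M = 1)
    (hN : ∀ j : Fin (n + 1), ¬ (j : ℕ) < n - 1 →
      ∃ α β : k, ∀ i, N i j = α * v i + β * w i) (a b : Fin (n + 1) → K)
    (ha : ∀ i : Fin (n + 1), (i : ℕ) < n - 1 → (M.map (algebraMap k K)).mulVec a i = 0)
    (hb : ∀ i : Fin (n + 1), (i : ℕ) < n - 1 → (M.map (algebraMap k K)).mulVec b i = 0)
    (hFa : aeval a F = 0) (hFb : aeval b F = 0) (i j : Fin (n + 1)) : a i * b j = a j * b i := by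
  have key : ∀ a : Fin (n + 1) → K,
      (∀ i : Fin (n + 1), (i : ℕ) < n - 1 → (M.map (algebraMap k K)).mulVec a i = 0) →
      aeval a F = 0 → ∃ c : K, a = c • p := by
    intro a ha hFa
    have hterm : ∀ j, ∃ α β : K, ∀ i, algebraMap k K (N i j) *
        (M.map (algebraMap k K)).mulVec a j
          = α * algebraMap k K (v i) + β * algebraMap k K (w i) := by
      intro j
      by_cases hj : (j : ℕ) < n - 1
      · exact ⟨0, 0, fun i => by simp [ha j hj]⟩
      · obtain ⟨α, β, h⟩ := hN j hj
        refine ⟨algebraMap k K α * (M.map (algebraMap k K)).mulVec a j,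
          algebraMap k K β * (M.map (algebraMap k K)).mulVec a j, fun i => ?_⟩
        rw [h i, map_add, map_mul, map_mul]
        ring
    choose α β hαβ using hterm
    have haeq : a = (∑ j, α j) • (algebraMap k K ∘ v) + (∑ j, β j) • (algebraMap k K ∘ w) := by
      have hinv : (N.map (algebraMap k K)).mulVec ((M.map (algebraMap k K)).mulVec a) = a := by
        rw [Matrix.mulVec_mulVec, ← Matrix.map_mul, hNM]
        simp
      ext i
      conv_lhs => rw [← hinv]
      simp only [Matrix.mulVec, dotProduct, Matrix.map_apply] at hαβ ⊢
      simp only [hαβ, Finset.sum_add_distrib, ← Finset.sum_mul, Pi.add_apply, Pi.smul_apply,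
        Function.comp_apply, smul_eq_mul]
    by_cases h0 : (∑ j, α j) = 0 ∧ (∑ j, β j) = 0
    · exact ⟨0, by rw [haeq, h0.1, h0.2]; simp⟩
    · obtain ⟨c, hc⟩ := hLX _ _ h0 (by rw [← haeq, eval_map]; exact hFa)
      exact ⟨c, haeq.trans hc⟩
  obtain ⟨c, rfl⟩ := key a ha hFa
  obtain ⟨c', rfl⟩ := key b hb hFb
  simp only [Pi.smul_apply, smul_eq_mul]
  ring

theorem araH_le_of_hypersurface_with_total_tangent_line_prod_P1
    (k : Type*) [Field k] (n d : ℕ) (hn : 1 ≤ n) (hd : 1 ≤ d)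
    (F : MvPolynomial (Fin (n+1)) k) (hF : F.IsHomogeneous d) (hF0 : F ≠ 0)
    -- the line `L`, spanned by `v` and `w`:
    (v w : Fin (n+1) → k) (hvw : LinearIndependent k ![v, w])
    -- the point `P`:
    (p : Fin (n+1) → AlgebraicClosure k) (hp : p ≠ 0)
    (hpL : ∃ a b : AlgebraicClosure k,
      p = a • (algebraMap k (AlgebraicClosure k) ∘ v)
        + b • (algebraMap k (AlgebraicClosure k) ∘ w))
    -- `L` meets `X` exactly at the point `P` (over the algebraic closure):
    (hLX : ∀ a b : AlgebraicClosure k, ¬(a = 0 ∧ b = 0) →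
      (MvPolynomial.eval
          (a • (algebraMap k (AlgebraicClosure k) ∘ v)
            + b • (algebraMap k (AlgebraicClosure k) ∘ w))
          (F.map (algebraMap k (AlgebraicClosure k))) = 0
        ↔ ∃ c : AlgebraicClosure k, c ≠ 0 ∧
            a • (algebraMap k (AlgebraicClosure k) ∘ v)
              + b • (algebraMap k (AlgebraicClosure k) ∘ w) = c • p)) :
    araH (segreIdeal k n 1 (Ideal.span {F}) ⊥) ≤ 2*n ∧
    -- after a change of coordinates one may assume `L = V₊((x₀,…,x_{n−2}))`, and then:
    (Submodule.span k {v, w}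
        = Submodule.span k {Pi.single (⟨n-1, by omega⟩ : Fin (n+1)) (1 : k),
            Pi.single (Fin.last n) (1 : k)} →
      (Ideal.span ({colSubst 0 F, colSubst 1 F} ∪
          Set.range (fun t : Fin (2*n-2) => hPoly (k := k) (n := n) (t + 1)))).radical
        = (segreIdeal k n 1 (Ideal.span {F}) ⊥).radical) := by
  have hline := fun {M N : Matrix (Fin (n + 1)) (Fin (n + 1)) k} (hNM : N * M = 1) =>
    proportional_of_mem_line (K := AlgebraicClosure k) (F := F) (v := v) (w := w) (p := p)
      (fun a b hab h => ((hLX a b hab).mp h).imp fun _ hc => hc.2) hNM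
  have hlast : ∀ j : Fin (n + 1), ¬ (j : ℕ) < n - 1 → j = ⟨n - 1, by omega⟩ ∨ j = Fin.last n := by
    intro j hj
    have := j.isLt
    simp only [Fin.ext_iff, Fin.val_last]
    omega
  constructor
  · let r : Fin 2 → Fin (n + 1) := ![⟨n - 1, by omega⟩, Fin.last n]
    have hr : Function.Injective r := by
      intro i j hij
      fin_cases i <;> fin_cases j <;> simp [r, Fin.ext_iff] at hij ⊢ <;> omega
    obtain ⟨e, he⟩ := exists_linearEquiv_of_linearIndependent
      ((Pi.basisFun k (Fin (n + 1))).linearIndependent.comp r hr) hvw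
    have hNM : LinearMap.toMatrix' (e : (Fin (n + 1) → k) →ₗ[k] Fin (n + 1) → k) *
        LinearMap.toMatrix' (e.symm : (Fin (n + 1) → k) →ₗ[k] Fin (n + 1) → k) = 1 := by
      rw [← LinearMap.toMatrix'_comp]
      simp
    refine araH_segreIdeal_le_of_radical_eq hn _ hF
      (radical_span_segreEquations hNM hF (hline hNM fun j hj => ?_))
    rcases hlast j hj with rfl | rfl
    · refine ⟨1, 0, fun i => ?_⟩
      have := congrFun (he 0) i
      simpa [r, LinearMap.toMatrix'_apply, Pi.single_apply] using this
    · refine ⟨0, 1, fun i => ?_⟩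
      have := congrFun (he 1) i
      simpa [r, LinearMap.toMatrix'_apply, Pi.single_apply] using this
  · intro hspan
    have hrad := radical_span_segreEquations (one_mul (1 : Matrix _ _ k)) hF
      (hline (one_mul 1) fun j hj => ?_)
    · simpa only [segreEquations, rowSubst_one] using hrad
    · have hmem : Pi.single j (1 : k) ∈ Submodule.span k {v, w} := by
        rw [hspan]
        rcases hlast j hj with rfl | rfl
        · exact Submodule.subset_span (.inl rfl)
        · exact Submodule.subset_span (.inr rfl)
      obtain ⟨α, β, h⟩ := Submodule.mem_span_pair.mp hmem
      refine ⟨α, β, fun i => ?_⟩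
      have := congrFun h i
      simpa [Matrix.one_apply, Pi.single_apply] using this.symm
end

section
/- Let k be an algebraically closed field, let X ⊆ P^n be a smooth hypersurface of degree d with d ≤ 2n−3, and let I be the ideal of P = k[z_{ij} : 0 ≤ i ≤ n, j = 0,1] defining the Segre product X × P^1 ⊆ P^{2n+1}. Then ara_h(I) ≤ 2n. -/
/-!
STATEMENT 11: Let `k` be an algebraically closed field, let `X ⊆ ℙⁿ` be a smooth
hypersurface of degree `d` with `d ≤ 2n−3`, and let `I` be the ideal of
`P = k[z_{ij} : 0 ≤ i ≤ n, j = 0,1]` defining the Segre product `X × ℙ¹ ⊆ ℙ^{2n+1}`.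
Then `ara_h(I) ≤ 2n`.
-/

open MvPolynomial

/-- smoothness of the projective hypersurface `V₊(F) ⊆ ℙⁿ` over an algebraically closed
field `k`: the Jacobian criterion. -/
def IsSmoothHypersurface' {k : Type*} [Field k] {n : ℕ}
    (F : MvPolynomial (Fin (n+1)) k) : Prop :=
  ∀ v : Fin (n+1) → k, v ≠ 0 →
    ¬ (MvPolynomial.eval v F = 0 ∧ ∀ i, MvPolynomial.eval v (MvPolynomial.pderiv i F) = 0)


/-- A self-map of a power of `R⟦X⟧` that respects congruences modulo powers of `X` becomes
contracting after multiplication by `X`, and therefore has a fixed point. -/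
theorem PowerSeries.exists_eq_X_mul {R ι : Type*} [CommRing R]
    (Φ : (ι → PowerSeries R) → ι → PowerSeries R)
    (hΦ : ∀ m c c', (∀ i, (PowerSeries.X ^ m : PowerSeries R) ∣ c i - c' i) →
      ∀ i, (PowerSeries.X ^ m : PowerSeries R) ∣ Φ c i - Φ c' i) :
    ∃ c, ∀ i, c i = PowerSeries.X * Φ c i := by
  let T : (ι → PowerSeries R) → ι → PowerSeries R := fun c i => PowerSeries.X * Φ c i
  have hT : ∀ m c c', (∀ i, (PowerSeries.X ^ m : PowerSeries R) ∣ c i - c' i) →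
      ∀ i, (PowerSeries.X ^ (m + 1) : PowerSeries R) ∣ T c i - T c' i := by
    intro m c c' h i
    have := mul_dvd_mul_left (PowerSeries.X : PowerSeries R) (hΦ m c c' h i)
    rwa [← pow_succ', mul_sub] at this
  let s : ℕ → ι → PowerSeries R := fun m => T^[m] 0
  have hs : ∀ m, s (m + 1) = T (s m) := fun m => Function.iterate_succ_apply' T m 0
  have hstep : ∀ m i, (PowerSeries.X ^ m : PowerSeries R) ∣ s (m + 1) i - s m i := by
    intro m
    induction m with
    | zero => simp
    | succ m ih =>
      intro i
      rw [hs (m + 1), hs m]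
      exact hT m _ _ (by simpa only [hs m] using ih) i
  have hcauchy : ∀ m j i, (PowerSeries.X ^ m : PowerSeries R) ∣ s (m + j) i - s m i := by
    intro m j i
    induction j with
    | zero => simp
    | succ j ih =>
      have h := (pow_dvd_pow (PowerSeries.X : PowerSeries R) (Nat.le_add_right m j)).trans
        (hstep (m + j) i)
      simpa [add_assoc] using dvd_add h ih
  let c : ι → PowerSeries R := fun i => PowerSeries.mk fun j => PowerSeries.coeff j (s (j + 1) i)
  have hc : ∀ m i, (PowerSeries.X ^ m : PowerSeries R) ∣ c i - s m i := by
    intro m i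
    rw [PowerSeries.X_pow_dvd_iff]
    intro j hj
    obtain ⟨e, rfl⟩ := Nat.exists_eq_add_of_lt hj
    have h := PowerSeries.X_pow_dvd_iff.1 (hcauchy (j + 1) e i) j (Nat.lt_succ_self j)
    rw [map_sub, sub_eq_zero] at h
    rw [map_sub, PowerSeries.coeff_mk, sub_eq_zero, ← h, add_right_comm]
  refine ⟨c, fun i => ?_⟩
  ext m
  have h₁ := hc (m + 1 + 1) i
  have h₂ := hT (m + 1) _ _ (hc (m + 1)) i
  rw [← hs] at h₂
  have h := PowerSeries.X_pow_dvd_iff.1 (dvd_sub h₁ h₂) m (by omega)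
  rwa [sub_sub_sub_cancel_right, map_sub, sub_eq_zero] at h

/-- A system of polynomial equations over an algebraically closed field that has a solution in
some nontrivial algebra has a solution in the field. -/
theorem MvPolynomial.exists_forall_aeval_eq_zero_of_algebra {k κ σ : Type*} [Field k]
    [IsAlgClosed k] [Finite σ] [CommRing κ] [Nontrivial κ] [Algebra k κ]
    (S : Set (MvPolynomial σ k)) (x : σ → κ) (hx : ∀ p ∈ S, aeval x p = 0) :
    ∃ y : σ → k, ∀ p ∈ S, aeval y p = 0 := by
  have hS : Ideal.span S ≠ ⊤ := by
    intro h
    have hle : Ideal.span S ≤ RingHom.ker (aeval (R := k) x) := Ideal.span_le.2 hx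
    have h1 : (1 : MvPolynomial σ k) ∈ RingHom.ker (aeval (R := k) x) :=
      hle (h ▸ Submodule.mem_top)
    simp [RingHom.mem_ker] at h1
  obtain ⟨M, hM, hSM⟩ := Ideal.exists_le_maximal _ hS
  obtain ⟨y, rfl⟩ := eq_vanishingIdeal_singleton_of_isMaximal k hM
  exact ⟨y, fun p hp => hSM (Ideal.subset_span hp) y rfl⟩

/-- Scaling the argument of a homogeneous polynomial of degree `d` by `c` scales its value by
`c ^ d`. -/
theorem MvPolynomial.aeval_mul_of_isHomogeneous {R A ι : Type*} [CommSemiring R] [CommSemiring A]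
    [Algebra R A] {d : ℕ} {P : MvPolynomial ι R} (hP : P.IsHomogeneous d) (c : A) (w : ι → A) :
    aeval (fun i => c * w i) P = c ^ d * aeval w P := by
  rw [aeval_def, aeval_def, eval₂_eq, eval₂_eq, Finset.mul_sum]
  refine Finset.sum_congr rfl fun e he => ?_
  rw [hP.degree_eq_sum_deg_support he]
  simp only [mul_pow, Finset.prod_mul_distrib, Finset.prod_pow_eq_pow_sum]
  ring

/-- A homogeneous polynomial vanishing on an affine line vanishes on the plane it spans. -/
theorem MvPolynomial.aeval_smul_add_smul_eq_zero_of_isHomogeneous {K ι : Type*} [Field K]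
    [Infinite K] {d : ℕ} {P : MvPolynomial ι K} (hP : P.IsHomogeneous d) {v w : ι → K}
    (h : ∀ t : K, aeval (t • v + w) P = 0) (a b : K) : aeval (a • v + b • w) P = 0 := by
  have hne : ∀ a b : K, b ≠ 0 → aeval (a • v + b • w) P = 0 := by
    intro a b hb
    have : a • v + b • w = fun i => b * ((a / b) • v + w) i := by
      funext i
      simp only [Pi.add_apply, Pi.smul_apply, smul_eq_mul]
      field_simp
    rw [this, aeval_mul_of_isHomogeneous hP, h, mul_zero]
  let Q : Polynomial K :=
    aeval (fun i => Polynomial.C (a * v i) + Polynomial.X * Polynomial.C (w i)) P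
  have hQ : ∀ t, Q.eval t = aeval (a • v + t • w) P := by
    intro t
    rw [← Polynomial.coe_aeval_eq_eval, ← AlgHom.comp_apply, comp_aeval]
    congr 2
    funext i
    simp [mul_comm (w i)]
  have hXQ : Polynomial.X * Q = 0 := by
    refine Polynomial.funext fun t => ?_
    rcases eq_or_ne t 0 with rfl | ht
    · simp
    · simp [hQ, hne a t ht]
  have hQ0 : Q = 0 := (mul_eq_zero.1 hXQ).resolve_left Polynomial.X_ne_zero
  rw [← hQ, hQ0, Polynomial.eval_zero]

/-- A finite nonzero family in a field can be normalized at a valuation subring. -/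
theorem ValuationSubring.exists_forall_div_mem {K ι : Type*} [Field K] [Finite ι]
    (B : ValuationSubring K) {w : ι → K} (hw : w ≠ 0) :
    ∃ i, w i ≠ 0 ∧ ∀ j, w j / w i ∈ B := by
  obtain ⟨j₀, hj₀⟩ := Function.ne_iff.1 hw
  have : Nonempty ι := ⟨j₀⟩
  obtain ⟨i, hi⟩ := Finite.exists_max fun j => B.valuation (w j)
  have hwi : w i ≠ 0 := by
    intro h
    have := hi j₀
    rw [h, map_zero, le_zero_iff, map_eq_zero] at this
    exact hj₀ this
  refine ⟨i, hwi, fun j => ?_⟩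
  rw [← B.valuation_le_one_iff, map_div₀]
  exact div_le_one_of_le₀ (hi j) zero_le

/-- A valuation subring over `k` centred at a given transcendental element. -/
theorem exists_valuationSubring_of_transcendental {k K : Type*} [Field k] [Field K] [Algebra k K]
    {u : K} (hu : Transcendental k u) :
    ∃ B : ValuationSubring K, (∀ c : k, algebraMap k K c ∈ B) ∧ u ∈ B.nonunits := by
  let A : Subalgebra k K := Algebra.adjoin k {u}
  let u' : A.toSubring := ⟨u, Algebra.self_mem_adjoin_singleton k u⟩
  have hI : Ideal.span {u'} ≠ ⊤ := by
    rw [Ne, Ideal.span_singleton_eq_top]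
    intro h
    obtain ⟨⟨y, hy⟩, hyu⟩ := h.exists_right_inv
    have hyA : y ∈ Algebra.adjoin k {u} := hy
    obtain ⟨p, rfl⟩ := (Algebra.adjoin_mem_exists_aeval k u hyA)
    have hyu : u * Polynomial.aeval u p = 1 := congrArg Subtype.val hyu
    have h0 : Polynomial.X * p - 1 = 0 :=
      transcendental_iff.1 hu _ (by simp [hyu])
    have := congrArg (Polynomial.eval 0) h0
    simp at this
  obtain ⟨B, hAB, hB⟩ := Ideal.image_subset_nonunits_valuationSubring _ hI
  exact ⟨B, fun c => hAB (A.algebraMap_mem c),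
    hB ⟨u', Ideal.mem_span_singleton_self u', rfl⟩⟩

/-- If `F` deforms, over a field `K ⊇ k`, into a form that vanishes on a plane of `K ^ ι`, then `F`
itself vanishes on a plane of `k ^ ι`. -/
theorem MvPolynomial.exists_plane_of_deformation {k K ι : Type*} [Field k] [IsAlgClosed k]
    [Field K] [Algebra k K] [Finite ι] {u : K} (hu : Transcendental k u) (F G : MvPolynomial ι k)
    {w₁ w₂ : ι → K} (hw : LinearIndependent K ![w₁, w₂])
    (hFG : ∀ a b : K, aeval (a • w₁ + b • w₂) F + u * aeval (a • w₁ + b • w₂) G = 0) :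
    ∃ v₁ v₂ : ι → k, LinearIndependent k ![v₁, v₂] ∧
      ∀ a b : k, aeval (a • v₁ + b • v₂) F = 0 := by
  obtain ⟨B, hkB, huB⟩ := exists_valuationSubring_of_transcendental hu
  rw [LinearIndependent.pair_iff] at hw
  have hw₁ : w₁ ≠ 0 := by
    rintro rfl
    exact one_ne_zero (hw 1 0 (by simp)).1
  obtain ⟨i, hi, hiB⟩ := B.exists_forall_div_mem hw₁
  have hw₂ : w₂ - (w₂ i / w₁ i) • w₁ ≠ 0 := by
    intro h
    refine one_ne_zero (hw (-(w₂ i / w₁ i)) 1 ?_).2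
    rw [← h]
    module
  obtain ⟨j, hj, hjB⟩ := B.exists_forall_div_mem hw₂
  set w₃ := w₂ - (w₂ i / w₁ i) • w₁ with hw₃
  have hw₃i : w₃ i = 0 := by
    simp [hw₃, hi]
  let x₁ : ι → B := fun l => ⟨w₁ l / w₁ i, hiB l⟩
  let x₂ : ι → B := fun l => ⟨w₃ l / w₃ j, hjB l⟩
  let φ : k →+* B := (algebraMap k K).codRestrict B hkB
  let ρ : B →+* IsLocalRing.ResidueField B := IsLocalRing.residue B
  have hres : ∀ a b : B, eval₂ (ρ.comp φ) (fun l => ρ (a * x₁ l + b * x₂ l)) F = 0 := by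
    intro a b
    have hcoe : ∀ P : MvPolynomial ι k, ((eval₂ φ (fun l => a * x₁ l + b * x₂ l) P : B) : K) =
        aeval (fun l => (a : K) * (w₁ l / w₁ i) + b * (w₃ l / w₃ j)) P := by
      intro P
      rw [aeval_def]
      exact eval₂_comp_left B.subtype φ _ P
    have hpt : (fun l => (a : K) * (w₁ l / w₁ i) + b * (w₃ l / w₃ j)) =
        ((a : K) / w₁ i - b / w₃ j * (w₂ i / w₁ i)) • w₁ + ((b : K) / w₃ j) • w₂ := by
      funext l
      simp only [hw₃, Pi.add_apply, Pi.smul_apply, Pi.sub_apply, smul_eq_mul]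
      ring
    have huB' : u ∈ B := B.nonunits_subset huB
    have hB : eval₂ φ (fun l => a * x₁ l + b * x₂ l) F +
        ⟨u, huB'⟩ * eval₂ φ (fun l => a * x₁ l + b * x₂ l) G = 0 := by
      apply Subtype.ext
      have := hFG ((a : K) / w₁ i - b / w₃ j * (w₂ i / w₁ i)) ((b : K) / w₃ j)
      rw [← hpt, ← hcoe, ← hcoe] at this
      exact this
    have hρu : ρ ⟨u, huB'⟩ = 0 := by
      rw [IsLocalRing.residue_eq_zero_iff]
      exact (ValuationSubring.coe_mem_nonunits_iff (A := B) (a := ⟨u, huB'⟩)).1 huB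
    have := congrArg ρ hB
    rw [map_add, map_mul, hρu, zero_mul, add_zero, map_zero] at this
    rw [← this]
    exact (eval₂_comp_left ρ φ _ F).symm
  let _ : Algebra k (IsLocalRing.ResidueField B) := (ρ.comp φ).toAlgebra
  let S : Set (MvPolynomial (ι ⊕ ι) k) :=
    {X (Sum.inl i) - 1, X (Sum.inr i), X (Sum.inr j) - 1} ∪
      Set.range fun t : k × k =>
        aeval (fun l => C t.1 * X (Sum.inl l) + C t.2 * X (Sum.inr l)) F
  obtain ⟨y, hy⟩ := exists_forall_aeval_eq_zero_of_algebra S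
    (Sum.elim (fun l => ρ (x₁ l)) (fun l => ρ (x₂ l))) (by
      have hx₁ : x₁ i = 1 := Subtype.ext (div_self hi)
      have hx₂ : x₂ j = 1 := Subtype.ext (div_self hj)
      have hx₃ : x₂ i = 0 := Subtype.ext (by simp [x₂, hw₃i])
      rintro p (hp | ⟨⟨a, b⟩, rfl⟩)
      · rcases hp with rfl | rfl | rfl
        · simp [hx₁]
        · simp [hx₃]
        · simp [hx₂]
      · have := hres (φ a) (φ b)
        rw [← AlgHom.comp_apply, comp_aeval, aeval_def, ← this]
        congr 1
        funext l
        simp only [map_add, map_mul, aeval_X, Sum.elim_inl, Sum.elim_inr]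
        congr 2 <;> exact algHom_C _ _)
  have h₁ : y (Sum.inl i) = 1 := by
    have := hy (X (Sum.inl i) - 1) (by simp [S])
    rwa [map_sub, aeval_X, map_one, sub_eq_zero] at this
  have h₂ : y (Sum.inr i) = 0 := by simpa using hy (X (Sum.inr i)) (by simp [S])
  have h₃ : y (Sum.inr j) = 1 := by
    have := hy (X (Sum.inr j) - 1) (by simp [S])
    rwa [map_sub, aeval_X, map_one, sub_eq_zero] at this
  refine ⟨fun l => y (Sum.inl l), fun l => y (Sum.inr l), ?_, fun a b => ?_⟩
  · rw [LinearIndependent.pair_iff]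
    intro s t hst
    have hs : s = 0 := by simpa [h₁, h₂] using congrFun hst i
    exact ⟨hs, by simpa [h₃, hs] using congrFun hst j⟩
  · have := hy _ (Or.inr ⟨(a, b), rfl⟩)
    rw [← AlgHom.comp_apply, comp_aeval] at this
    rw [← this]
    congr 2
    funext l
    simp

/-- Coefficients of polynomials obtained by substitution into `F` respect congruences. -/
theorem MvPolynomial.dvd_coeff_aeval_sub {k R ι : Type*} [CommRing k] [CommRing R] [Algebra k R]
    (F : MvPolynomial ι k) (r : R) {f g : ι → Polynomial R}
    (h : ∀ i j, r ∣ (f i).coeff j - (g i).coeff j) (j : ℕ) :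
    r ∣ (aeval f F).coeff j - (aeval g F).coeff j := by
  let π := Ideal.Quotient.mkₐ k (Ideal.span {r})
  have hπ : ∀ a b : R, r ∣ a - b ↔ π a = π b := by
    intro a b
    rw [← Ideal.mem_span_singleton]
    exact (Ideal.Quotient.mk_eq_mk_iff_sub_mem a b).symm
  have hmap : ∀ f : ι → Polynomial R, Polynomial.mapAlgHom π (aeval f F) =
      aeval (fun i => Polynomial.mapAlgHom π (f i)) F := by
    intro f
    rw [← AlgHom.comp_apply, comp_aeval]
  have hfg : (fun i => Polynomial.mapAlgHom π (f i)) = fun i => Polynomial.mapAlgHom π (g i) := by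
    funext i
    ext l
    simpa using (hπ _ _).1 (h i l)
  have := congrArg (Polynomial.coeff · j) ((hmap f).trans ((congrArg (aeval · F) hfg).trans
    (hmap g).symm))
  rw [hπ]
  simpa using this

/-- A polynomial of degree at most `d`, with `d + 1 ≤ 2 * m`, splits into consecutive pairs of
monomials. -/
theorem Polynomial.sum_range_pair_eq {R : Type*} [CommRing R] {d m : ℕ} (hd : d + 1 ≤ 2 * m)
    {H : Polynomial R} (hH : H.natDegree ≤ d) (h1 : 1 ≤ d) :
    ∑ i : Fin m, (C (if 2 * (i : ℕ) = d then H.coeff d else H.coeff (2 * i + 1)) * X +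
      C (if 2 * (i : ℕ) = d then 0 else H.coeff (2 * i))) * X ^ min (2 * (i : ℕ)) (d - 1) = H := by
  have hpair : ∀ M : ℕ, ∑ i ∈ Finset.range M,
      (C (H.coeff (2 * i + 1)) * X + C (H.coeff (2 * i))) * X ^ (2 * i) =
        ∑ j ∈ Finset.range (2 * M), C (H.coeff j) * X ^ j := by
    intro M
    induction M with
    | zero => simp
    | succ M ih =>
      rw [Finset.sum_range_succ, ih, show 2 * (M + 1) = 2 * M + 1 + 1 by ring,
        Finset.sum_range_succ, Finset.sum_range_succ]
      ring
  conv_rhs => rw [H.as_sum_range_C_mul_X_pow' (show H.natDegree < 2 * m by omega), ← hpair,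
    ← Fin.sum_univ_eq_sum_range
      (fun i => (C (H.coeff (2 * i + 1)) * X + C (H.coeff (2 * i))) * X ^ (2 * i))]
  refine Finset.sum_congr rfl fun i _ => ?_
  rcases lt_trichotomy (2 * (i : ℕ)) d with hi | hi | hi
  · rw [if_neg hi.ne, if_neg hi.ne, min_eq_left (by omega)]
  · have h0 : H.coeff (d + 1) = 0 := coeff_eq_zero_of_natDegree_lt (by omega)
    rw [if_pos hi, if_pos hi, hi, min_eq_right (by omega), h0, map_zero, zero_mul, zero_add,
      add_zero, mul_assoc, ← pow_succ', Nat.sub_add_cancel h1]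
  · have h0 : H.coeff (2 * i) = 0 := coeff_eq_zero_of_natDegree_lt (by omega)
    have h0' : H.coeff (2 * i + 1) = 0 := coeff_eq_zero_of_natDegree_lt (by omega)
    simp [hi.ne', h0, h0']

/-- The form `∑ xᵢ gᵢ(y₀, y₁)` in which the `gᵢ` are monomials of degree `d - 1`. -/
noncomputable def lineForm (k : Type*) [CommRing k] (m d : ℕ) :
    MvPolynomial (Fin m ⊕ Fin 2) k :=
  ∑ i : Fin m, X (Sum.inl i) * X (Sum.inr 0) ^ min (2 * (i : ℕ)) (d - 1) *
    X (Sum.inr 1) ^ (d - 1 - min (2 * (i : ℕ)) (d - 1))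

theorem isHomogeneous_lineForm (k : Type*) [CommRing k] {m d : ℕ} (hd : 1 ≤ d) :
    (lineForm k m d).IsHomogeneous d := by
  refine IsHomogeneous.sum _ _ _ fun i _ => ?_
  have h := ((isHomogeneous_X k (Sum.inl i : Fin m ⊕ Fin 2)).mul
    (isHomogeneous_X_pow (R := k) (Sum.inr 0 : Fin m ⊕ Fin 2) (min (2 * (i : ℕ)) (d - 1)))).mul
    (isHomogeneous_X_pow (R := k) (Sum.inr 1 : Fin m ⊕ Fin 2)
      (d - 1 - min (2 * (i : ℕ)) (d - 1)))
  convert! h using 1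
  omega

theorem PowerSeries.transcendental_X {k : Type*} [CommRing k] :
    Transcendental k (PowerSeries.X : PowerSeries k) := by
  rw [transcendental_iff]
  intro p hp
  have h : Polynomial.aeval (PowerSeries.X : PowerSeries k) =
      Polynomial.coeToPowerSeries.algHom (R := k) k := by
    ext1
    simp
  rw [h] at hp
  simpa using hp

theorem exists_formal_line {k : Type*} [CommRing k] {m d : ℕ} (hd : 1 ≤ d)
    (hdm : d + 1 ≤ 2 * m) {F : MvPolynomial (Fin m ⊕ Fin 2) k} (hF : F.IsHomogeneous d) :
    ∃ p q : Fin m → PowerSeries k,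
      let f : Fin m ⊕ Fin 2 → Polynomial (PowerSeries k) :=
        Sum.elim (fun i => Polynomial.C (p i) * Polynomial.X + Polynomial.C (q i))
          ![Polynomial.X, 1]
      aeval f (lineForm k m d) + Polynomial.C PowerSeries.X * aeval f F = 0 := by
  let f : (Fin m ⊕ Fin m → PowerSeries k) → Fin m ⊕ Fin 2 → Polynomial (PowerSeries k) := fun c =>
    Sum.elim (fun i => Polynomial.C (c (Sum.inl i)) * Polynomial.X + Polynomial.C (c (Sum.inr i)))
      ![Polynomial.X, 1]
  have hf : ∀ c i, (f c i).natDegree ≤ 1 := by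
    rintro c (i | i)
    · exact Polynomial.natDegree_linear_le
    · fin_cases i
      · exact Polynomial.natDegree_X_le
      · simp [f]
  let H : (Fin m ⊕ Fin m → PowerSeries k) → Polynomial (PowerSeries k) := fun c => -aeval (f c) F
  have hH : ∀ c, (H c).natDegree ≤ d := by
    intro c
    rw [Polynomial.natDegree_neg]
    have h := aeval_natDegree_le _ (hF.map (algebraMap k (PowerSeries k))).totalDegree_le (f c)
      (hf c)
    rwa [aeval_map_algebraMap, mul_one] at h
  have hHdvd : ∀ (r : PowerSeries k) c c', (∀ i, r ∣ c i - c' i) →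
      ∀ j, r ∣ (H c).coeff j - (H c').coeff j := by
    intro r c c' h j
    have := dvd_coeff_aeval_sub F r (f := f c') (g := f c) (by
      rintro (i | i) j
      · have h₁ := (dvd_sub_comm (a := r)).1 (h (Sum.inl i))
        have h₂ := (dvd_sub_comm (a := r)).1 (h (Sum.inr i))
        rcases j with _ | _ | j
        · simpa [f] using h₂
        · simpa [f] using h₁
        · simp [f]
      · simp [f]) j
    simpa [H, neg_add_eq_sub] using this
  obtain ⟨c, hc⟩ := PowerSeries.exists_eq_X_mul
    (fun c => Sum.elim
      (fun i : Fin m => if 2 * (i : ℕ) = d then (H c).coeff d else (H c).coeff (2 * i + 1))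
      (fun i : Fin m => if 2 * (i : ℕ) = d then 0 else (H c).coeff (2 * i))) (by
    rintro e c c' h (i | i)
    · by_cases hi : 2 * (i : ℕ) = d
      · simpa [hi] using hHdvd _ c c' h d
      · simpa [hi] using hHdvd _ c c' h _
    · by_cases hi : 2 * (i : ℕ) = d
      · simp [hi]
      · simpa [hi] using hHdvd _ c c' h _)
  refine ⟨fun i => c (Sum.inl i), fun i => c (Sum.inr i), ?_⟩
  change aeval (f c) (lineForm k m d) + Polynomial.C PowerSeries.X * aeval (f c) F = 0
  have key : aeval (f c) (lineForm k m d) = Polynomial.C PowerSeries.X * H c := by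
    conv_rhs => rw [← Polynomial.sum_range_pair_eq hdm (hH c) hd, Finset.mul_sum]
    rw [lineForm, map_sum]
    refine Finset.sum_congr rfl fun i _ => ?_
    have h₁ := hc (Sum.inl i)
    have h₂ := hc (Sum.inr i)
    simp only [Sum.elim_inl, Sum.elim_inr] at h₁ h₂
    simp only [map_mul, map_pow, aeval_X, f, Sum.elim_inl, Sum.elim_inr, Matrix.cons_val_zero,
      Matrix.cons_val_one, one_pow, mul_one]
    rw [h₁, h₂, map_mul, map_mul]
    ring
  rw [key, ← mul_add, show H c + aeval (f c) F = 0 from neg_add_cancel _, mul_zero]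

/-- A hypersurface of degree `d` in projective space of dimension `m + 1` contains a line as soon
as `d + 1 ≤ 2 * m`. -/
theorem MvPolynomial.IsHomogeneous.exists_plane {k : Type*} [Field k] [IsAlgClosed k] {m d : ℕ}
    (hd : 1 ≤ d) (hdm : d + 1 ≤ 2 * m) {F : MvPolynomial (Fin m ⊕ Fin 2) k}
    (hF : F.IsHomogeneous d) :
    ∃ v₁ v₂ : Fin m ⊕ Fin 2 → k, LinearIndependent k ![v₁, v₂] ∧
      ∀ a b : k, MvPolynomial.aeval (a • v₁ + b • v₂) F = 0 := by
  obtain ⟨p, q, hpq⟩ := exists_formal_line hd hdm hF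
  let K := FractionRing (PowerSeries k)
  let s : K := algebraMap (PowerSeries k) K PowerSeries.X
  have hs : s ≠ 0 := by simp [s]
  have hs' : Transcendental k s :=
    (transcendental_algebraMap_iff (IsFractionRing.injective (PowerSeries k) K)).2
      PowerSeries.transcendental_X
  have : Infinite K := Infinite.of_injective _ (algebraMap k K).injective
  let w₁ : Fin m ⊕ Fin 2 → K := Sum.elim (fun i => algebraMap _ K (p i)) ![1, 0]
  let w₂ : Fin m ⊕ Fin 2 → K := Sum.elim (fun i => algebraMap _ K (q i)) ![0, 1]
  have hline : ∀ t : K, MvPolynomial.aeval (t • w₁ + w₂) (lineForm k m d) +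
      s * MvPolynomial.aeval (t • w₁ + w₂) F = 0 := by
    intro t
    let ev : Polynomial (PowerSeries k) →ₐ[k] K :=
      (Polynomial.aeval t : _ →ₐ[PowerSeries k] K).restrictScalars k
    have hev : ∀ P : MvPolynomial (Fin m ⊕ Fin 2) k, ev (MvPolynomial.aeval (Sum.elim
        (fun i => Polynomial.C (p i) * Polynomial.X + Polynomial.C (q i))
        ![Polynomial.X, 1]) P) = MvPolynomial.aeval (t • w₁ + w₂) P := by
      intro P
      rw [← AlgHom.comp_apply, comp_aeval]
      congr 2
      funext i
      rcases i with i | i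
      · simp [ev, w₁, w₂, mul_comm t]
      · fin_cases i <;> simp [ev, w₁, w₂]
    have h := congrArg ev hpq
    rw [map_add, map_mul, hev, hev, map_zero] at h
    rw [← h]
    congr 2
    simp [ev, s]
  refine exists_plane_of_deformation (K := K) (u := s⁻¹) (fun h => hs' (IsAlgebraic.inv_iff.1 h))
    F (lineForm k m d) (w₁ := w₁) (w₂ := w₂) ?_ fun a b => ?_
  · rw [LinearIndependent.pair_iff]
    intro a b hab
    exact ⟨by simpa [w₁, w₂] using congrFun hab (Sum.inr 0),
      by simpa [w₁, w₂] using congrFun hab (Sum.inr 1)⟩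
  · let P : MvPolynomial (Fin m ⊕ Fin 2) K := map (algebraMap k K) (lineForm k m d) +
      C s * map (algebraMap k K) F
    have hP : P.IsHomogeneous d :=
      ((isHomogeneous_lineForm k hd).map _).add ((hF.map _).C_mul s)
    have hPe : ∀ x, MvPolynomial.aeval x P =
        MvPolynomial.aeval x (lineForm k m d) + s * MvPolynomial.aeval x F := by
      intro x
      rw [map_add, map_mul, aeval_map_algebraMap, aeval_map_algebraMap, aeval_C]
      rfl
    have h := aeval_smul_add_smul_eq_zero_of_isHomogeneous hP (v := w₁) (w := w₂)
      (fun t => (hPe _).trans (hline t)) a b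
    rw [hPe] at h
    rw [eq_neg_of_add_eq_zero_left h, mul_neg, inv_mul_cancel_left₀ hs, add_neg_cancel]

/-- Linear coordinates in which a given plane is cut out by the first coordinates. -/
theorem exists_linearEquiv_of_linearIndependent_pair {k V : Type*} [Field k] [AddCommGroup V]
    [Module k V] [FiniteDimensional k V] {m : ℕ} (hV : Module.finrank k V = m + 2) {v₁ v₂ : V}
    (hv : LinearIndependent k ![v₁, v₂]) :
    ∃ e : V ≃ₗ[k] (Fin (m + 2) → k), ∀ z, (∀ i : Fin m, e z (Fin.castAdd 2 i) = 0) →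
      ∃ a b : k, a • v₁ + b • v₂ = z := by
  let W := Submodule.span k (Set.range ![v₁, v₂])
  have hW : Module.finrank k W = 2 := by simpa using finrank_span_eq_card hv
  obtain ⟨W', hWW'⟩ := Submodule.exists_isCompl W
  have hW' : Module.finrank k W' = m := by
    have := Submodule.finrank_add_eq_of_isCompl hWW'
    omega
  let E := Submodule.prodEquivOfIsCompl W' W hWW'.symm
  let b := (((Module.finBasisOfFinrankEq k W' hW').prod
    (Module.finBasisOfFinrankEq k W hW)).map E).reindex finSumFinEquiv
  refine ⟨b.equivFun, fun z hz => ?_⟩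
  have hz' : (E.symm z).1 = 0 := by
    refine (Module.finBasisOfFinrankEq k W' hW').ext_elem fun i => ?_
    have := hz i
    simpa [b] using this
  have hzW : z ∈ W := (Submodule.prodEquivOfIsCompl_symm_apply_fst_eq_zero _ _ hWW'.symm).1 hz'
  have hab : ∃ a b : k, a • v₂ + b • v₁ = z := by simpa [W, Submodule.mem_span_pair] using hzW
  obtain ⟨a, b, h⟩ := hab
  exact ⟨b, a, by rw [add_comm, h]⟩

/-- The maximal minors of a `2 × N` matrix vanish up to a given level as soon as their sums over
levels do. -/
theorem minor_eq_zero_of_sum_eq_zero {k : Type*} [Field k] {N L : ℕ} (a b : Fin N → k)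
    (h : ∀ l, 1 ≤ l → l ≤ L →
      ∑ p : Fin N × Fin N with p.1 < p.2 ∧ (p.1 : ℕ) + p.2 = l,
        (a p.1 * b p.2 - a p.2 * b p.1) = 0) :
    ∀ l, l ≤ L → ∀ i j : Fin N, i < j → (i : ℕ) + j = l → a i * b j - a j * b i = 0 := by
  intro l
  induction l using Nat.strong_induction_on with
  | _ l ih =>
    intro hl i j hij hijl
    have hmin : ∀ i' j' : Fin N, i' < j' → (i' : ℕ) + j' < l → a i' * b j' - a j' * b i' = 0 :=
      fun i' j' h₁ h₂ => ih _ h₂ (by omega) i' j' h₁ rfl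
    have hprod : ∀ p q : Fin N, p < q → (p : ℕ) + q = l → (p, q) ≠ (i, j) →
        (a i * b j - a j * b i) * (a p * b q - a q * b p) = 0 := by
      intro p q hpq hpql hne
      rcases lt_trichotomy p i with hpi | rfl | hpi
      · have h₁ := hmin p i hpi (by omega)
        have h₂ := hmin p j (by omega) (by omega)
        linear_combination -(a j * b q - a q * b j) * h₁ + (a i * b q - a q * b i) * h₂
      · have hqj : q = j := Fin.ext (by omega)
        exact absurd (by rw [hqj]) hne
      · have h₁ := hmin i p hpi (by omega)
        have h₂ := hmin i q (by omega) (by omega)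
        linear_combination -(a q * b j - a j * b q) * h₁ + (a p * b j - a j * b p) * h₂
    have hs := congrArg ((a i * b j - a j * b i) * ·) (h l (by omega) hl)
    simp only [mul_zero, Finset.mul_sum] at hs
    rw [Finset.sum_eq_single (i, j)] at hs
    · exact mul_self_eq_zero.1 hs
    · rintro ⟨p, q⟩ hp hne
      simp only [Finset.mem_filter, Finset.mem_univ, true_and] at hp
      exact hprod p q hp.1 hp.2 hne
    · intro hn
      exact absurd (by simpa using ⟨hij, hijl⟩) hn

/-- Two vectors whose minors vanish are multiples of a common vector. -/
theorem exists_smul_eq_of_minors_eq_zero {k ι : Type*} [Field k] [LinearOrder ι] (a b : ι → k)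
    (h : ∀ i j, i < j → a i * b j - a j * b i = 0) :
    ∃ (x : ι → k) (s t : k), a = s • x ∧ b = t • x := by
  have h' : ∀ i j, a i * b j = a j * b i := by
    intro i j
    rcases lt_trichotomy i j with hij | rfl | hij
    · exact sub_eq_zero.1 (h i j hij)
    · rfl
    · exact (sub_eq_zero.1 (h j i hij)).symm
  by_cases ha : a = 0
  · exact ⟨b, 0, 1, by simp [ha], by simp⟩
  · obtain ⟨i, hi⟩ := Function.ne_iff.1 ha
    simp only [Pi.zero_apply] at hi
    refine ⟨a, 1, b i / a i, by simp, funext fun j => ?_⟩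
    simp only [Pi.smul_apply, smul_eq_mul]
    rw [div_mul_eq_mul_div, eq_div_iff hi]
    linear_combination h' i j

section SegreEquations

universe u

variable {k : Type u} [Field k] {n : ℕ}

/-- The `i`-th coordinate of the image of the `j`-th column of `z` under `e`. -/
noncomputable def columnForm (e : (Fin (n + 1) → k) ≃ₗ[k] (Fin (n + 1) → k)) (i : Fin (n + 1))
    (j : Fin 2) : MvPolynomial (Fin (n + 1) × Fin 2) k :=
  ∑ l, C (e (Pi.single l 1) i) * X (l, j)

/-- The minor of the rows `i` and `j` of the matrix of coordinates of the two columns of `z`. -/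
noncomputable def columnMinor (e : (Fin (n + 1) → k) ≃ₗ[k] (Fin (n + 1) → k))
    (i j : Fin (n + 1)) : MvPolynomial (Fin (n + 1) × Fin 2) k :=
  columnForm e i 0 * columnForm e j 1 - columnForm e j 0 * columnForm e i 1

/-- The equation `F(z_{·j})`, squared and corrected by a multiple of the last minor. -/
noncomputable def correctedForm (e : (Fin (n + 1) → k) ≃ₗ[k] (Fin (n + 1) → k)) (d : ℕ)
    (F : MvPolynomial (Fin (n + 1)) k) (i₀ i₁ : Fin (n + 1)) (j : Fin 2) :
    MvPolynomial (Fin (n + 1) × Fin 2) k :=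
  rename (fun l => (l, j)) F ^ 2 + columnMinor e i₀ i₁ * columnForm e i₀ j ^ (2 * d - 2)

variable (e : (Fin (n + 1) → k) ≃ₗ[k] (Fin (n + 1) → k))

theorem isHomogeneous_columnForm (i : Fin (n + 1)) (j : Fin 2) :
    (columnForm e i j).IsHomogeneous 1 :=
  IsHomogeneous.sum _ _ _ fun _ _ => isHomogeneous_C_mul_X _ _

theorem isHomogeneous_columnMinor (i j : Fin (n + 1)) : (columnMinor e i j).IsHomogeneous 2 :=
  ((isHomogeneous_columnForm e i 0).mul (isHomogeneous_columnForm e j 1)).sub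
    ((isHomogeneous_columnForm e j 0).mul (isHomogeneous_columnForm e i 1))

theorem isHomogeneous_correctedForm {d : ℕ} (hd : 1 ≤ d) {F : MvPolynomial (Fin (n + 1)) k}
    (hF : F.IsHomogeneous d) (i₀ i₁ : Fin (n + 1)) (j : Fin 2) :
    (correctedForm e d F i₀ i₁ j).IsHomogeneous (2 * d) := by
  refine IsHomogeneous.add ?_ ?_
  · rw [mul_comm]
    exact hF.rename_isHomogeneous.pow 2
  · convert! (isHomogeneous_columnMinor e i₀ i₁).mul
      ((isHomogeneous_columnForm e i₀ j).pow (2 * d - 2)) using 1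
    omega

theorem aeval_columnForm (z : Fin (n + 1) × Fin 2 → k) (i : Fin (n + 1)) (j : Fin 2) :
    aeval z (columnForm e i j) = e (fun l => z (l, j)) i := by
  conv_rhs => rw [pi_eq_sum_univ' (fun l => z (l, j))]
  simp [columnForm, map_sum, mul_comm]

theorem aeval_columnMinor_eq_zero {A : Type*} [CommRing A] [Algebra k A] (x : Fin (n + 1) → A)
    (y : Fin 2 → A) (i j : Fin (n + 1)) :
    aeval (fun p : Fin (n + 1) × Fin 2 => x p.1 * y p.2) (columnMinor e i j) = 0 := by
  have h : ∀ i j, aeval (fun p : Fin (n + 1) × Fin 2 => x p.1 * y p.2) (columnForm e i j) =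
      (∑ l, algebraMap k A (e (Pi.single l 1) i) * x l) * y j := by
    intro i j
    rw [columnForm, map_sum, Finset.sum_mul]
    refine Finset.sum_congr rfl fun l _ => ?_
    rw [map_mul, aeval_X, aeval_C, mul_assoc]
  rw [columnMinor, map_sub, map_mul, map_mul, h, h, h, h]
  ring

theorem aeval_rename_column {A : Type*} [CommRing A] [Algebra k A] {d : ℕ}
    {F : MvPolynomial (Fin (n + 1)) k} (hF : F.IsHomogeneous d) (x : Fin (n + 1) → A)
    (y : Fin 2 → A) (j : Fin 2) :
    aeval (fun p : Fin (n + 1) × Fin 2 => x p.1 * y p.2) (rename (fun l => (l, j)) F) =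
      y j ^ d * aeval x F := by
  rw [aeval_rename, ← aeval_mul_of_isHomogeneous hF]
  congr 2
  funext l
  exact mul_comm _ _

/-- A polynomial belongs to the Segre ideal when it vanishes at every point of the Segre product
with values in a `k`-algebra. -/
theorem mem_segreIdeal_of_forall_aeval_eq_zero {F : MvPolynomial (Fin (n + 1)) k} {m : ℕ}
    {P : MvPolynomial (Fin (n + 1) × Fin (m + 1)) k}
    (hP : ∀ (A : Type u) [CommRing A] [Algebra k A] (x : Fin (n + 1) → A) (y : Fin (m + 1) → A),
      aeval x F = 0 → aeval (fun p : Fin (n + 1) × Fin (m + 1) => x p.1 * y p.2) P = 0) :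
    P ∈ segreIdeal k n m (Ideal.span {F}) ⊥ := by
  rw [segreIdeal, RingHom.mem_ker]
  simp only [map_mul]
  refine hP _ (fun i => Ideal.Quotient.mk _ (X (Sum.inl i)))
    (fun j => Ideal.Quotient.mk _ (X (Sum.inr j))) ?_
  have h : rename (Sum.inl : Fin (n + 1) → Fin (n + 1) ⊕ Fin (m + 1)) F ∈
      (Ideal.span {F}).map (rename (Sum.inl : Fin (n + 1) → Fin (n + 1) ⊕ Fin (m + 1))) ⊔
        (⊥ : Ideal (MvPolynomial (Fin (m + 1)) k)).map (rename (R := k) Sum.inr) :=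
    Ideal.mem_sup_left (Ideal.mem_map_of_mem _ (Ideal.mem_span_singleton_self F))
  rw [← Ideal.Quotient.eq_zero_iff_mem] at h
  rw [← h, ← Ideal.Quotient.mkₐ_eq_mk k, rename_eq_aeval, ← AlgHom.comp_apply, comp_aeval]
  rfl

theorem aeval_eq_zero_of_mem_segreIdeal_s10 {F : MvPolynomial (Fin (n + 1)) k} {m : ℕ}
    {P : MvPolynomial (Fin (n + 1) × Fin (m + 1)) k} (hP : P ∈ segreIdeal k n m (Ideal.span {F}) ⊥)
    {x : Fin (n + 1) → k} (hx : aeval x F = 0) (y : Fin (m + 1) → k) :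
    aeval (fun p => x p.1 * y p.2) P = 0 := by
  let J := (Ideal.span {F}).map (rename (Sum.inl : Fin (n + 1) → Fin (n + 1) ⊕ Fin (m + 1))) ⊔
    (⊥ : Ideal (MvPolynomial (Fin (m + 1)) k)).map (rename (R := k) Sum.inr)
  have hJ : J ≤ RingHom.ker (aeval (R := k) (Sum.elim x y)) := by
    refine sup_le ?_ (by simp)
    rw [Ideal.map_le_iff_le_comap, Ideal.span_le, Set.singleton_subset_iff]
    change aeval (Sum.elim x y) (rename Sum.inl F) = 0
    rw [aeval_rename, Sum.elim_comp_inl, hx]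
  let ψ := Ideal.Quotient.liftₐ J (aeval (R := k) (Sum.elim x y)) fun a ha => hJ ha
  have hψ : aeval (fun p => x p.1 * y p.2) = ψ.comp (aeval (R := k)
      (fun p : Fin (n + 1) × Fin (m + 1) =>
        Ideal.Quotient.mk J (X (Sum.inl p.1) * X (Sum.inr p.2)))) := by
    refine algHom_ext fun p => ?_
    rw [AlgHom.comp_apply, aeval_X, aeval_X]
    change _ = aeval (R := k) (Sum.elim x y) _
    simp
  rw [hψ, AlgHom.comp_apply]
  exact (congrArg ψ hP).trans (map_zero ψ)

end SegreEquations

/-- The Nullstellensatz bound: `araH I ≤ t` as soon as `t` forms in `I` cut out its zero locus. -/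
theorem araH_le_of_forall_zero {k σ : Type*} [Field k] [IsAlgClosed k] [Finite σ] {t : ℕ}
    {I : Ideal (MvPolynomial σ k)} (f : Fin t → MvPolynomial σ k)
    (hf : ∀ i, ∃ d, (f i).IsHomogeneous d) (hfI : ∀ i, f i ∈ I)
    (hI : ∀ z : σ → k, (∀ i, aeval z (f i) = 0) → ∀ P ∈ I, aeval z P = 0) : araH I ≤ t := by
  refine Nat.sInf_le ⟨f, hf, le_antisymm ?_ ?_⟩
  · exact Ideal.radical_mono (Ideal.span_le.2 (Set.range_subset_iff.2 hfI))
  · rw [Ideal.radical_le_radical_iff, ← vanishingIdeal_zeroLocus_eq_radical (K := k)]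
    intro P hP
    rw [mem_vanishingIdeal_iff]
    intro z hz
    rw [zeroLocus_span] at hz
    exact hI z (fun i => hz _ ⟨i, rfl⟩) P hP

/-- The equations of `X × ℙ¹`, where `e` gives coordinates in which a plane on which `F` vanishes is
cut out by all coordinates but the last two. -/
noncomputable def segreEquation {k : Type*} [Field k] {m : ℕ}
    (e : (Fin (m + 1 + 1) → k) ≃ₗ[k] (Fin (m + 1 + 1) → k)) (d : ℕ)
    (F : MvPolynomial (Fin (m + 1 + 1)) k) :
    Fin (2 * m) ⊕ Fin 2 → MvPolynomial (Fin (m + 1 + 1) × Fin 2) k :=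
  Sum.elim
    (fun l => ∑ p : Fin (m + 1 + 1) × Fin (m + 1 + 1) with
      p.1 < p.2 ∧ (p.1 : ℕ) + p.2 = l + 1, columnMinor e p.1 p.2)
    (correctedForm e d F (Fin.last m).castSucc (Fin.last (m + 1)))

section

universe u

variable {k : Type u} [Field k] {m d : ℕ} (e : (Fin (m + 1 + 1) → k) ≃ₗ[k] (Fin (m + 1 + 1) → k))
  {F : MvPolynomial (Fin (m + 1 + 1)) k}

theorem exists_isHomogeneous_segreEquation (hd : 1 ≤ d) (hF : F.IsHomogeneous d)
    (i : Fin (2 * m) ⊕ Fin 2) : ∃ D, (segreEquation e d F i).IsHomogeneous D := by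
  cases i with
  | inl l => exact ⟨2, IsHomogeneous.sum _ _ _ fun p _ => isHomogeneous_columnMinor e p.1 p.2⟩
  | inr j => exact ⟨2 * d, isHomogeneous_correctedForm e hd hF _ _ j⟩

theorem segreEquation_mem_segreIdeal (hF : F.IsHomogeneous d) (i : Fin (2 * m) ⊕ Fin 2) :
    segreEquation e d F i ∈ segreIdeal k (m + 1) 1 (Ideal.span {F}) ⊥ := by
  refine mem_segreIdeal_of_forall_aeval_eq_zero fun A _ _ x y hx => ?_
  cases i with
  | inl l =>
    simp only [segreEquation, Sum.elim_inl, map_sum]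
    exact Finset.sum_eq_zero fun p _ => aeval_columnMinor_eq_zero e x y p.1 p.2
  | inr j =>
    simp only [segreEquation, Sum.elim_inr, correctedForm, map_add, map_mul, map_pow]
    have h := aeval_columnMinor_eq_zero e x y (Fin.last m).castSucc (Fin.last (m + 1))
    have h' := aeval_rename_column hF x y j
    rw [hx, mul_zero] at h'
    rw [show aeval (fun p : Fin (m + 1 + 1) × Fin (1 + 1) => x p.1 * y p.2) (columnMinor e _ _) = 0
      from h, show aeval (fun p : Fin (m + 1 + 1) × Fin (1 + 1) => x p.1 * y p.2)
        (rename (fun l => (l, j)) F) = 0 from h']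
    ring

/-- The common zeros of the equations are the points of the Segre product. -/
theorem exists_eq_mul_of_aeval_segreEquation_eq_zero (hd : 1 ≤ d) (hF : F.IsHomogeneous d)
    (he : ∀ w, (∀ i : Fin m, e w i.castSucc.castSucc = 0) → aeval w F = 0)
    {z : Fin (m + 1 + 1) × Fin 2 → k} (hz : ∀ i, aeval z (segreEquation e d F i) = 0) :
    ∃ (x : Fin (m + 1 + 1) → k) (y : Fin 2 → k), aeval x F = 0 ∧ z = fun p => x p.1 * y p.2 := by
  set a : Fin (m + 1 + 1) → k := e fun l => z (l, 0) with ha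
  set b : Fin (m + 1 + 1) → k := e fun l => z (l, 1) with hb
  have hminor : ∀ i j, aeval z (columnMinor e i j) = a i * b j - a j * b i := by
    intro i j
    simp only [columnMinor, map_sub, map_mul, aeval_columnForm, ha, hb]
  have hlow := minor_eq_zero_of_sum_eq_zero (L := 2 * m) a b fun l h₁ hl => by
    have := hz (Sum.inl ⟨l - 1, by omega⟩)
    simp only [segreEquation, Sum.elim_inl, map_sum, hminor, Nat.sub_add_cancel h₁] at this
    exact this
  have hcol : ∀ j : Fin 2, aeval (fun l => z (l, j)) F ^ 2 +
      (a (Fin.last m).castSucc * b (Fin.last (m + 1)) -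
        a (Fin.last (m + 1)) * b (Fin.last m).castSucc) *
      e (fun l => z (l, j)) (Fin.last m).castSucc ^ (2 * d - 2) = 0 := by
    intro j
    have := hz (Sum.inr j)
    simp only [segreEquation, Sum.elim_inr, correctedForm, map_add, map_mul, map_pow, hminor,
      aeval_columnForm, aeval_rename] at this
    exact this
  by_cases h₀ : a (Fin.last m).castSucc * b (Fin.last (m + 1)) -
      a (Fin.last (m + 1)) * b (Fin.last m).castSucc = 0
  · have hcol' : ∀ j : Fin 2, aeval (fun l => z (l, j)) F = 0 := fun j => by
      have := hcol j
      rw [h₀, zero_mul, add_zero] at this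
      exact pow_eq_zero_iff two_ne_zero |>.1 this
    obtain ⟨x, s, t, hs, ht⟩ := exists_smul_eq_of_minors_eq_zero a b fun i j hij => by
      by_cases hl : (i : ℕ) + j ≤ 2 * m
      · exact hlow _ hl i j hij rfl
      · have hi : i = (Fin.last m).castSucc := Fin.ext (by simp; omega)
        have hj : j = Fin.last (m + 1) := Fin.ext (by simp; omega)
        rw [hi, hj, h₀]
    have hz' : z = fun p => e.symm x p.1 * ![s, t] p.2 := by
      funext ⟨l, j⟩
      fin_cases j
      · have := congrFun (congrArg e.symm hs) l
        simpa [ha, mul_comm] using this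
      · have := congrFun (congrArg e.symm ht) l
        simpa [hb, mul_comm] using this
    by_cases hx : aeval (e.symm x) F = 0
    · exact ⟨e.symm x, ![s, t], hx, hz'⟩
    · have hy : ∀ j, ![s, t] j = 0 := fun j => by
        have := hcol' j
        rw [hz'] at this
        simp only [mul_comm (e.symm x _)] at this
        rw [aeval_mul_of_isHomogeneous hF] at this
        exact pow_eq_zero_iff (by omega) |>.1 ((mul_eq_zero.1 this).resolve_right hx)
      refine ⟨0, 0, ?_, ?_⟩
      · have := aeval_mul_of_isHomogeneous hF (0 : k) (e.symm x)
        rw [zero_pow (by omega), zero_mul] at this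
        rw [← this]
        congr 2
        funext i
        simp
      · rw [hz']
        funext p
        simp [hy]
  · exfalso
    have hab : ∀ i : Fin m, a i.castSucc.castSucc = 0 ∧ b i.castSucc.castSucc = 0 := by
      intro i
      have h₁ := hlow _ (show (i.castSucc.castSucc : ℕ) + (Fin.last m).castSucc ≤ 2 * m by
        simp; omega) _ _ (by simp [Fin.lt_def]) rfl
      have h₂ := hlow _ (show (i.castSucc.castSucc : ℕ) + Fin.last (m + 1) ≤ 2 * m by
        simp; omega) _ _ (by simp [Fin.lt_def]) rfl
      constructor
      · refine (mul_eq_zero.1 ?_).resolve_left h₀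
        linear_combination a (Fin.last m).castSucc * h₂ - a (Fin.last (m + 1)) * h₁
      · refine (mul_eq_zero.1 ?_).resolve_left h₀
        linear_combination b (Fin.last m).castSucc * h₂ - b (Fin.last (m + 1)) * h₁
    have hcol' : ∀ j : Fin 2, aeval (fun l => z (l, j)) F = 0 →
        e (fun l => z (l, j)) (Fin.last m).castSucc = 0 := fun j hj => by
      have := hcol j
      rw [hj, zero_pow two_ne_zero, zero_add] at this
      exact eq_zero_of_pow_eq_zero ((mul_eq_zero.1 this).resolve_left h₀)
    have ha₀ : a (Fin.last m).castSucc = 0 := hcol' 0 (he _ fun i => (hab i).1)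
    have hb₀ : b (Fin.last m).castSucc = 0 := hcol' 1 (he _ fun i => (hab i).2)
    exact h₀ (by rw [ha₀, hb₀, zero_mul, mul_zero, sub_zero])

end

theorem MvPolynomial.IsHomogeneous.exists_linearEquiv {k : Type*} [Field k] [IsAlgClosed k]
    {m d : ℕ} (hd : 1 ≤ d) (hdm : d + 1 ≤ 2 * m) {F : MvPolynomial (Fin (m + 1 + 1)) k}
    (hF : F.IsHomogeneous d) :
    ∃ e : (Fin (m + 1 + 1) → k) ≃ₗ[k] (Fin (m + 1 + 1) → k),
      ∀ w, (∀ i : Fin m, e w i.castSucc.castSucc = 0) → MvPolynomial.aeval w F = 0 := by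
  let σ : Fin m ⊕ Fin 2 ≃ Fin (m + 1 + 1) := finSumFinEquiv
  obtain ⟨v₁, v₂, hv, hvF⟩ :=
    (hF.rename_isHomogeneous (f := σ.symm)).exists_plane hd hdm
  let φ := LinearEquiv.funCongrLeft k k σ.symm
  have hv' : LinearIndependent k ![φ v₁, φ v₂] := by
    convert! hv.map' φ.toLinearMap φ.ker using 1
    funext i
    fin_cases i <;> rfl
  obtain ⟨e, he⟩ := exists_linearEquiv_of_linearIndependent_pair (m := m) (by simp) hv'
  refine ⟨e, fun w hw => ?_⟩
  obtain ⟨a, b, rfl⟩ := he w hw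
  have := hvF a b
  rwa [aeval_rename] at this

theorem araH_le_of_smooth_hypersurface_prod_P1
    (k : Type*) [Field k] [IsAlgClosed k] (n d : ℕ) (hn : 1 ≤ n) (hd : 1 ≤ d)
    (hdn : d ≤ 2*n - 3)
    (F : MvPolynomial (Fin (n+1)) k) (hF : F.IsHomogeneous d)
    (hsm : IsSmoothHypersurface' F) :
    araH (segreIdeal k n 1 (Ideal.span {F}) ⊥) ≤ 2*n := by
  obtain ⟨m, rfl⟩ := Nat.exists_eq_add_of_le' hn
  obtain ⟨e, he⟩ := hF.exists_linearEquiv hd (by omega)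
  refine araH_le_of_forall_zero (t := 2 * m + 2) (fun i => segreEquation e d F
    (finSumFinEquiv.symm i)) (fun i => exists_isHomogeneous_segreEquation e hd hF _)
    (fun i => segreEquation_mem_segreIdeal e hF _) fun z hz P hP => ?_
  obtain ⟨x, y, hx, rfl⟩ := exists_eq_mul_of_aeval_segreEquation_eq_zero e hd hF he (z := z)
    fun i => by simpa only [Equiv.symm_apply_apply] using hz (finSumFinEquiv i)
  exact aeval_eq_zero_of_mem_segreIdeal_s10 hP hx y
end
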